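/- arXiv:2405.15785 — 8 statements merged into one kernel-verified Lean document; each statement's English description precedes it below -/
import Mathlib

section
/- Let (J,⊙) be an algebra (a finite-dimensional vector space over K with a bilinear product ⊙, not assumed commutative). Then the symmetrized product x·y := x⊙y + y⊙x makes (J,·) a Jacobi–Jordan algebra if and only if, for all x, y, z ∈ J, the cyclic sum of the anti-associators satisfies ∮(x,y,z)^⊙ = −∮(x,z,y)^⊙, i.e. [(x,y,z)^⊙ + (y,z,x)^⊙ + (z,x,y)^⊙] = −[(x,z,y)^⊙ + (y,x,z)^⊙ + (z,y,x)^⊙]. -/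
/-- The anti-associator `(x,y,z)^⊙ = x⊙(y⊙z) + (x⊙y)⊙z` of a (bilinear) product `p`. -/
def aassoc {K V : Type*} [Field K] [AddCommGroup V] [Module K V]
    (p : V →ₗ[K] V →ₗ[K] V) (x y z : V) : V :=
  p x (p y z) + p (p x y) z

/-- For an algebra `(J,⊙)` (finite-dimensional over a field of characteristic
`≠ 2, 3`), the symmetrized product `x·y = x⊙y + y⊙x` makes `(J,·)` a Jacobi–Jordan algebra
(commutative and satisfying the Jacobi identity) if and only if
`∮(x,y,z)^⊙ = −∮(x,z,y)^⊙` for all `x, y, z`. -/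
theorem stmt0 {K V : Type*} [Field K] [AddCommGroup V] [Module K V]
    [FiniteDimensional K V] (h2 : (2 : K) ≠ 0) (h3 : (3 : K) ≠ 0)
    (p : V →ₗ[K] V →ₗ[K] V)
    (s : V → V → V) (hs : ∀ x y, s x y = p x y + p y x) :
    ((∀ x y, s x y = s y x) ∧
      (∀ x y z, s x (s y z) + s y (s z x) + s z (s x y) = 0)) ↔
    (∀ x y z : V,
      aassoc p x y z + aassoc p y z x + aassoc p z x y =
        -(aassoc p x z y + aassoc p y x z + aassoc p z y x)) := by
  have key : ∀ x y z : V, s x (s y z) + s y (s z x) + s z (s x y) =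
      (aassoc p x y z + aassoc p y z x + aassoc p z x y) +
        (aassoc p x z y + aassoc p y x z + aassoc p z y x) := by
    intro x y z
    simp only [hs, aassoc, map_add, LinearMap.add_apply]
    abel
  simp only [key, ← eq_neg_iff_add_eq_zero]
  exact and_iff_right fun x y => by rw [hs, hs, add_comm]
end

section
/- Let (J,⊙) be an algebra over K. If (J,⊙) is right-skew-symmetric, i.e. (x,y,z)^⊙ + (x,z,y)^⊙ = 0 for all x, y, z, or if (J,⊙) is left-skew-symmetric, i.e. (x,y,z)^⊙ + (y,x,z)^⊙ = 0 for all x, y, z, then (J,⊙) is an admissible JJ-algebra: the symmetrized product x·y := x⊙y + y⊙x makes (J,·) a Jacobi–Jordan algebra. -/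
/-- If an algebra `(J,⊙)` is right-skew-symmetric
(`(x,y,z)^⊙ + (x,z,y)^⊙ = 0`) or left-skew-symmetric (`(x,y,z)^⊙ + (y,x,z)^⊙ = 0`),
then it is an admissible JJ-algebra: the symmetrized product `x·y = x⊙y + y⊙x`
makes `(J,·)` a Jacobi–Jordan algebra. -/
theorem stmt1 {K V : Type*} [Field K] [AddCommGroup V] [Module K V]
    [FiniteDimensional K V] (h2 : (2 : K) ≠ 0) (h3 : (3 : K) ≠ 0)
    (p : V →ₗ[K] V →ₗ[K] V)
    (s : V → V → V) (hs : ∀ x y, s x y = p x y + p y x)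
    (h : (∀ x y z : V, aassoc p x y z + aassoc p x z y = 0) ∨
         (∀ x y z : V, aassoc p x y z + aassoc p y x z = 0)) :
    (∀ x y, s x y = s y x) ∧
      (∀ x y z, s x (s y z) + s y (s z x) + s z (s x y) = 0) := by
  refine ⟨fun x y => by rw [hs, hs, add_comm], fun x y z => ?_⟩
  simp only [hs, map_add, LinearMap.add_apply]
  simp only [aassoc] at h
  rcases h with h | h <;>
  linear_combination (norm := abel) h x y z + h y z x + h z x y
end

section
/- Let (J,·) be a Jacobi–Jordan algebra and θ a symmetric bilinear form on J. On the vector space J ⊕ Ke define the commutative bilinear product x ·_θ y = x·y + θ(x,y)e for x, y ∈ J, with e ·_θ z = z ·_θ e = 0 for all z. Then (J ⊕ Ke, ·_θ) is a Jacobi–Jordan algebra if and only if θ(x·y, z) + θ(z·x, y) + θ(y·z, x) = 0 for all x, y, z ∈ J. -/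
/-- Let `(J,·)` be a Jacobi–Jordan algebra and `θ` a symmetric bilinear form.
On `J ⊕ Ke` (modelled as `V × K`, with `e = (0,1)`), the product
`(x,s) ·_θ (y,t) = (x·y, θ(x,y))` (so that all products with `e` vanish) is a
Jacobi–Jordan product if and only if `θ(x·y,z) + θ(z·x,y) + θ(y·z,x) = 0` for all `x,y,z`. -/
theorem stmt3 {K V : Type*} [Field K] [AddCommGroup V] [Module K V]
    [FiniteDimensional K V] (h2 : (2 : K) ≠ 0) (h3 : (3 : K) ≠ 0)
    (m : V →ₗ[K] V →ₗ[K] V)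
    (hcomm : ∀ x y, m x y = m y x)
    (hjac : ∀ x y z, m x (m y z) + m y (m z x) + m z (m x y) = 0)
    (θ : V →ₗ[K] V →ₗ[K] K) (hθ : ∀ x y, θ x y = θ y x)
    (mθ : V × K → V × K → V × K)
    (hmθ : ∀ u v, mθ u v = (m u.1 v.1, θ u.1 v.1)) :
    ((∀ u v, mθ u v = mθ v u) ∧
      (∀ u v w, mθ u (mθ v w) + mθ v (mθ w u) + mθ w (mθ u v) = 0)) ↔
    (∀ x y z : V, θ (m x y) z + θ (m z x) y + θ (m y z) x = 0) := by
  constructor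
  · rintro ⟨-, h⟩ x y z
    have h' := congrArg Prod.snd (h (x, 0) (y, 0) (z, 0))
    simp only [hmθ, Prod.snd_add, Prod.snd_zero] at h'
    rw [hθ (m x y) z, hθ (m z x) y, hθ (m y z) x]
    linear_combination h'
  · intro h
    refine ⟨fun u v => by rw [hmθ, hmθ, hcomm, hθ], fun u v w => ?_⟩
    simp only [hmθ]
    refine Prod.ext (hjac u.1 v.1 w.1) ?_
    have h' := h u.1 v.1 w.1
    rw [hθ (m u.1 v.1), hθ (m w.1 u.1), hθ (m v.1 w.1)] at h'
    simp only [Prod.snd_add, Prod.snd_zero]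
    linear_combination h'
end

section
/- Let (J,·) be a Jacobi–Jordan algebra and θ a symmetric bilinear form on J satisfying θ(x·y,z) + θ(z·x,y) + θ(y·z,x) = 0 for all x,y,z, so that the central extension J_{θ,e} = J ⊕ Ke with product x ·_θ y = x·y + θ(x,y)e (and e central with all products with e equal to 0) is a JJ-algebra. Let D : J_{θ,e} → J_{θ,e} be a linear map and a ∈ J. On J̃ = Kd ⊕ J ⊕ Ke define the commutative bilinear product • by: x•y = x·y + θ(x,y)e for x,y ∈ J; d•z = z•d = D(z) for z ∈ J ⊕ Ke; d•d = a; e•z = z•e = 0 for z ∈ J ⊕ Ke. Then (J̃,•) is a Jacobi–Jordan algebra if and only if D is an anti-derivation of (J_{θ,e}, ·_θ), D(a) = 0, and D² = −(1/2)L_a, where L_a is left multiplication by a in J_{θ,e} (i.e. L_a(x) = a·x + θ(a,x)e for x ∈ J and L_a(e) = 0). -/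
section DoubleExtension

variable {K W : Type*} [Field K] [AddCommGroup W] [Module K W]

/-- The product on `K × W` extending a bilinear product `B` on `W` by an operator `D` and a
square `a`: `(s, x) * (t, y) = (0, (s * t) • a + B x y + s • D y + t • D x)`. -/
def extensionProduct (B : W →ₗ[K] W →ₗ[K] W) (D : W →ₗ[K] W) (a : W) (u v : K × W) : K × W :=
  (0, (u.1 * v.1) • a + B u.2 v.2 + u.1 • D v.2 + v.1 • D u.2)

theorem extensionProduct_comm {B : W →ₗ[K] W →ₗ[K] W} (hB : ∀ x y, B x y = B y x)
    (D : W →ₗ[K] W) (a : W) (u v : K × W) :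
    extensionProduct B D a u v = extensionProduct B D a v u := by
  simp only [extensionProduct, hB u.2 v.2, mul_comm u.1 v.1, Prod.mk.injEq, true_and]
  abel

theorem extensionProduct_jacobi_iff {B : W →ₗ[K] W →ₗ[K] W} (hB : ∀ x y, B x y = B y x)
    (D : W →ₗ[K] W) (a : W) (h2 : (2 : K) ≠ 0) (h3 : (3 : K) ≠ 0)
    (hJ : ∀ x y z, B x (B y z) + B y (B z x) + B z (B x y) = 0) :
    (∀ u v w, extensionProduct B D a u (extensionProduct B D a v w) +
      extensionProduct B D a v (extensionProduct B D a w u) +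
      extensionProduct B D a w (extensionProduct B D a u v) = 0) ↔
    (∀ x y, D (B x y) = -B (D x) y - B x (D y)) ∧ D a = 0 ∧
      ∀ z, D (D z) = -((2⁻¹ : K) • B a z) := by
  constructor
  · intro h
    refine ⟨fun x y => ?_, ?_, fun z => ?_⟩
    · have := congrArg Prod.snd (h (1, 0) (0, x) (0, y))
      simp [extensionProduct] at this
      rw [hB (D x) y]
      linear_combination (norm := module) this
    · have := congrArg Prod.snd (h (1, 0) (1, 0) (1, 0))
      simp [extensionProduct] at this
      have h' : (3 : K) • D a = 0 := by linear_combination (norm := module) this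
      exact (smul_eq_zero.mp h').resolve_left h3
    · have := congrArg Prod.snd (h (1, 0) (1, 0) (0, z))
      simp [extensionProduct] at this
      rw [hB a z]
      have h' : (2 : K) • D (D z) = -B z a := by linear_combination (norm := module) this
      rw [← smul_neg, ← h', smul_smul, inv_mul_cancel₀ h2, one_smul]
  · rintro ⟨hD, ha, hDD⟩ ⟨r, x⟩ ⟨s, y⟩ ⟨t, z⟩
    have hDD' (w : W) : B w a = -((2 : K) • D (D w)) := by
      rw [hDD, smul_neg, smul_smul, mul_inv_cancel₀ h2, one_smul, neg_neg, hB]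
    refine Prod.ext (by simp [extensionProduct]) ?_
    simp only [extensionProduct, Prod.snd_add, Prod.snd_zero, map_add, map_smul, ha, hD, hDD',
      hB (D x), hB (D y), hB (D z)]
    linear_combination (norm := module) hJ x y z

end DoubleExtension


/-- Double extension criterion (Proposition 2.1).  Let `(J,·)` be a JJ-algebra
and `θ` a symmetric bilinear cocycle, giving the central extension `J_{θ,e} = J ⊕ Ke`
(modelled as `V × K`, `e = (0,1)`, product `mθ (x,s) (y,t) = (x·y, θ(x,y))`).
Let `D : J_{θ,e} → J_{θ,e}` be linear, `a ∈ J`, and on `J̃ = Kd ⊕ J ⊕ Ke`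
(modelled as `K × V × K`, `d = (1,0,0)`, `e = (0,0,1)`) consider the commutative product
`•` with `x•y = x·y + θ(x,y)e`, `d•z = D(z)`, `d•d = a`, `e•z = 0`.
Then `(J̃,•)` is a Jacobi–Jordan algebra iff `D` is an anti-derivation of `J_{θ,e}`,
`D(a) = 0`, and `D² = −(1/2)L_a`. -/
theorem stmt4 {K V : Type*} [Field K] [AddCommGroup V] [Module K V]
    [FiniteDimensional K V] (h2 : (2 : K) ≠ 0) (h3 : (3 : K) ≠ 0)
    (m : V →ₗ[K] V →ₗ[K] V)
    (hcomm : ∀ x y, m x y = m y x)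
    (hjac : ∀ x y z, m x (m y z) + m y (m z x) + m z (m x y) = 0)
    (θ : V →ₗ[K] V →ₗ[K] K) (hθ : ∀ x y, θ x y = θ y x)
    (hcoc : ∀ x y z : V, θ (m x y) z + θ (m z x) y + θ (m y z) x = 0)
    (D : (V × K) →ₗ[K] (V × K)) (a : V)
    (mθ : V × K → V × K → V × K)
    (hmθ : ∀ u v, mθ u v = (m u.1 v.1, θ u.1 v.1))
    (bt : K × V × K → K × V × K → K × V × K)
    (hbt : ∀ u v, bt u v =
      ((0 : K),
       (u.1 * v.1) • a + m u.2.1 v.2.1 + u.1 • (D v.2).1 + v.1 • (D u.2).1,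
       θ u.2.1 v.2.1 + u.1 * (D v.2).2 + v.1 * (D u.2).2)) :
    ((∀ u v, bt u v = bt v u) ∧
      (∀ u v w, bt u (bt v w) + bt v (bt w u) + bt w (bt u v) = 0)) ↔
    ((∀ u v : V × K, D (mθ u v) = -(mθ (D u) v) - mθ u (D v)) ∧
      D (a, 0) = 0 ∧
      (∀ z : V × K, D (D z) = -((2⁻¹ : K) • ((m a z.1, θ a z.1) : V × K)))) := by
  let B : (V × K) →ₗ[K] (V × K) →ₗ[K] (V × K) :=
    LinearMap.mk₂ K (fun u v => (m u.1 v.1, θ u.1 v.1))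
      (by intros; simp) (by intros; simp) (by intros; simp) (by intros; simp)
  have hB_apply (u v : V × K) : B u v = (m u.1 v.1, θ u.1 v.1) := rfl
  have hB (u v : V × K) : B u v = B v u := by
    rw [hB_apply, hB_apply, hcomm, hθ]
  have hJ (x y z : V × K) : B x (B y z) + B y (B z x) + B z (B x y) = 0 := by
    refine Prod.ext (hjac x.1 y.1 z.1) ?_
    have := hcoc x.1 y.1 z.1
    simp only [hB_apply, Prod.snd_add, Prod.snd_zero]
    rw [hθ x.1, hθ y.1, hθ z.1]
    linear_combination this
  obtain rfl : mθ = fun u v => B u v := funext₂ hmθ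
  obtain rfl : bt = extensionProduct B D (a, 0) := by
    funext u v
    rw [hbt]
    refine Prod.ext rfl (Prod.ext ?_ ?_) <;> simp [extensionProduct, hB_apply]
  rw [and_iff_right (extensionProduct_comm hB D (a, 0))]
  exact extensionProduct_jacobi_iff hB D (a, 0) h2 h3 hJ
end

section
/- Let (J, ·, α, ω) be a cosymplectic Jacobi–Jordan algebra with Reeb vector ξ. Then ξ·ξ = 0. -/
/-- Evaluation of the wedge product `α ∧ ωⁿ` of a 1-form `α` and a 2-form `ω` on a tuple of
`2n+1` vectors, via the normalized (characteristic-free, "shuffle/matching") formula: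
the sum ranges over canonical representatives of the decompositions of `{0,…,2n}` into a
singleton (fed to `α`) and `n` ordered pairs (fed to `ω`).  `α ∧ ωⁿ ≠ 0` is rendered as
`∃ v, wedgeEval K n α ω v ≠ 0`. -/
def wedgeEval (K : Type*) [Field K] {V : Type*} (n : ℕ)
    (α : V → K) (ω : V → V → K) (v : Fin (2*n+1) → V) : K :=
  ∑ σ ∈ Finset.filter
      (fun σ : Equiv.Perm (Fin (2*n+1)) =>
        (∀ i : Fin n, σ ⟨2*(i:ℕ)+1, by have := i.2; omega⟩ < σ ⟨2*(i:ℕ)+2, by have := i.2; omega⟩) ∧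
        (∀ i j : Fin n, i < j →
          σ ⟨2*(i:ℕ)+1, by have := i.2; omega⟩ < σ ⟨2*(j:ℕ)+1, by have := j.2; omega⟩))
      Finset.univ,
    (Equiv.Perm.sign σ : ℤ) •
      (α (v (σ ⟨0, by omega⟩)) *
        ∏ i : Fin n,
          ω (v (σ ⟨2*(i:ℕ)+1, by have := i.2; omega⟩)) (v (σ ⟨2*(i:ℕ)+2, by have := i.2; omega⟩)))

/-- The index set `{0,…,2n}` as a singleton together with `n` pairs `(2i+1, 2i+2)`. -/
noncomputable def pairIndexEquiv (n : ℕ) : Option (Fin n × Bool) ≃ Fin (2*n+1) :=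
  Equiv.ofBijective
    (fun x => match x with
      | none => ⟨0, by omega⟩
      | some (i, false) => ⟨2*(i:ℕ)+1, by have := i.2; omega⟩
      | some (i, true) => ⟨2*(i:ℕ)+2, by have := i.2; omega⟩)
    (by
      rw [Fintype.bijective_iff_injective_and_card]
      constructor
      · rintro (_ | ⟨i, _ | _⟩) (_ | ⟨j, _ | _⟩) h <;>
          simp only [Fin.mk.injEq] at h <;> first | rfl | omega | skip
        all_goals
          have : i = j := Fin.ext (by omega)
          rw [this]
      · simp [mul_comm])

/-- The partner map on indices: it exchanges the two members of every pair. -/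
def pairFlip {n : ℕ} : Option (Fin n × Bool) → Option (Fin n × Bool) :=
  Option.map (Prod.map id not)

/-- `σ` lists every pair in increasing order, and the pairs by increasing first member. -/
def IsCanonical {n : ℕ} (σ : Equiv.Perm (Fin (2*n+1))) : Prop :=
  (∀ i, σ (pairIndexEquiv n (some (i, false))) < σ (pairIndexEquiv n (some (i, true)))) ∧
    StrictMono fun i => σ (pairIndexEquiv n (some (i, false)))

/-- `σ` and `σ'` describe the same decomposition into a singleton and unordered pairs. -/
def SameMatching {n : ℕ} (σ σ' : Equiv.Perm (Fin (2*n+1))) : Prop :=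
  ∃ g : Equiv.Perm (Option (Fin n × Bool)), (∀ x, g (pairFlip x) = pairFlip (g x)) ∧
    ∀ x, σ' (pairIndexEquiv n x) = σ (pairIndexEquiv n (g x))

/-- The summand of `wedgeEval` attached to `σ`. -/
noncomputable def wedgeTerm {K V : Type*} [Field K] {n : ℕ} (α : V → K) (ω : V → V → K)
    (v : Fin (2*n+1) → V) (σ : Equiv.Perm (Fin (2*n+1))) : K :=
  (Equiv.Perm.sign σ : ℤ) •
    (α (v (σ (pairIndexEquiv n none))) *
      ∏ i : Fin n, ω (v (σ (pairIndexEquiv n (some (i, false)))))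
        (v (σ (pairIndexEquiv n (some (i, true))))))

open Classical in
theorem wedgeEval_eq_sum_wedgeTerm {K V : Type*} [Field K] {n : ℕ} (α : V → K) (ω : V → V → K)
    (v : Fin (2*n+1) → V) :
    wedgeEval K n α ω v = ∑ σ with IsCanonical σ, wedgeTerm α ω v σ := by
  unfold wedgeEval
  refine Finset.sum_congr ?_ fun _ _ => rfl
  ext σ
  simp only [Finset.mem_filter, Finset.mem_univ, true_and]
  exact Iff.rfl

namespace SameMatching

variable {n : ℕ} {σ σ' σ'' : Equiv.Perm (Fin (2*n+1))}

theorem trans (h : SameMatching σ σ') (h' : SameMatching σ' σ'') : SameMatching σ σ'' := by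
  obtain ⟨g, hg, h⟩ := h
  obtain ⟨g', hg', h'⟩ := h'
  exact ⟨g * g', fun x => by simp [hg, hg'], fun x => by simp [h, h']⟩

theorem mul_left (h : SameMatching σ σ') (τ : Equiv.Perm (Fin (2*n+1))) :
    SameMatching (τ * σ) (τ * σ') := by
  obtain ⟨g, hg, h⟩ := h
  exact ⟨g, hg, fun x => by simp [h]⟩

theorem eq_of_isCanonical (h : SameMatching σ σ') (hσ : IsCanonical σ) (hσ' : IsCanonical σ') :
    σ = σ' := by
  obtain ⟨g, hg, h⟩ := h
  have hnone : g none = none := by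
    have := hg none
    rcases hgn : g none with _ | ⟨i, b⟩
    · rfl
    · simp [pairFlip] at this
      rw [hgn] at this
      cases b <;> simp at this
  have hfst : ∀ i, ∃ j, g (some (i, false)) = some (j, false) ∧
      g (some (i, true)) = some (j, true) := by
    intro i
    have hi := hg (some (i, false))
    have hlt := hσ'.1 i
    rw [h, h] at hlt
    rcases hgi : g (some (i, false)) with _ | ⟨j, _ | _⟩
    · exact absurd (g.injective (hgi.trans hnone.symm)) (by simp)
    · rw [hgi] at hi
      exact ⟨j, rfl, hi⟩
    · rw [hgi] at hi
      change g (some (i, true)) = some (j, false) at hi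
      rw [hgi, hi] at hlt
      exact absurd hlt (hσ.1 j).asymm
  choose π hπ using hfst
  have hπmono : StrictMono π := by
    intro i j hij
    have := hσ'.2 hij
    simp only [h, (hπ _).1] at this
    exact hσ.2.lt_iff_lt.1 this
  have hπid : π = id := by
    have hsurj : Function.Surjective π := Finite.injective_iff_surjective.1 hπmono.injective
    exact (hπmono.range_inj strictMono_id).1 (by simp [hsurj.range_eq])
  ext1 y
  obtain ⟨x, rfl⟩ := (pairIndexEquiv n).surjective y
  rw [h]
  rcases x with _ | ⟨i, _ | _⟩
  · rw [hnone]
  · rw [(hπ i).1, hπid, id]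
  · rw [(hπ i).2, hπid, id]

end SameMatching

section Relabelling

variable {K V : Type*} [Field K] {n : ℕ} (α : V → K) (ω : V → V → K)
  (v : Fin (2*n+1) → V) (σ : Equiv.Perm (Fin (2*n+1)))

theorem exists_sameMatching_ordered (hω : ∀ x y, ω y x = -ω x y) :
    ∃ σ', SameMatching σ σ' ∧
      (∀ i, σ' (pairIndexEquiv n (some (i, false))) < σ' (pairIndexEquiv n (some (i, true)))) ∧
      wedgeTerm α ω v σ' = wedgeTerm α ω v σ := by
  classical
  set e := pairIndexEquiv n
  let s : Fin n → Equiv.Perm Bool := fun i =>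
    if σ (e (some (i, false))) < σ (e (some (i, true))) then 1 else Equiv.swap false true
  let g : Equiv.Perm (Option (Fin n × Bool)) := Equiv.optionCongr (Equiv.prodCongrRight s)
  have hgn : g none = none := rfl
  have hgs : ∀ i b, g (some (i, b)) = some (i, s i b) := fun _ _ => rfl
  have happ : ∀ x, (σ * e.permCongr g) (e x) = σ (e (g x)) := by simp
  refine ⟨σ * e.permCongr g, ⟨g, ?_, happ⟩, ?_, ?_⟩
  · rintro (_ | ⟨i, b⟩)
    · rfl
    · change some (i, s i (!b)) = some (i, !(s i b))
      simp only [s]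
      split_ifs <;> cases b <;> simp
  · intro i
    rw [happ, happ, hgs, hgs]
    simp only [s]
    split_ifs with hi
    · simpa using hi
    · simp only [Equiv.swap_apply_left, Equiv.swap_apply_right]
      refine lt_of_le_of_ne (not_lt.1 hi) fun h => ?_
      simpa using e.injective (σ.injective h)
  · unfold wedgeTerm
    simp only [show pairIndexEquiv n = e from rfl, happ, hgn, hgs]
    have hsign : (Equiv.Perm.sign (σ * e.permCongr g) : ℤ) =
        Equiv.Perm.sign σ * ∏ i, (Equiv.Perm.sign (s i) : ℤ) := by
      simp [g, Equiv.optionCongr_sign, Equiv.Perm.sign_prodCongrRight]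
    have hfac : ∀ i, ω (v (σ (e (some (i, s i false))))) (v (σ (e (some (i, s i true))))) =
        ((Equiv.Perm.sign (s i) : ℤ) : K) *
          ω (v (σ (e (some (i, false))))) (v (σ (e (some (i, true))))) := by
      intro i
      simp only [s]
      split_ifs
      · simp
      · simp [hω (v (σ (e (some (i, false)))))]
    have hsq : (∏ i, ((Equiv.Perm.sign (s i) : ℤ) : K)) *
        ∏ i, ((Equiv.Perm.sign (s i) : ℤ) : K) = 1 := by
      rw [← Finset.prod_mul_distrib]
      refine Finset.prod_eq_one fun i _ => ?_
      rcases Int.units_eq_one_or (Equiv.Perm.sign (s i)) with h | h <;> simp [h]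
    simp only [hsign, hfac, Finset.prod_mul_distrib, zsmul_eq_mul]
    push_cast
    linear_combination ((Equiv.Perm.sign σ : ℤ) : K) * α (v (σ (e none))) *
      (∏ i, ω (v (σ (e (some (i, false))))) (v (σ (e (some (i, true)))))) * hsq

theorem exists_sameMatching_isCanonical (hω : ∀ x y, ω y x = -ω x y) :
    ∃ σ', SameMatching σ σ' ∧ IsCanonical σ' ∧ wedgeTerm α ω v σ' = wedgeTerm α ω v σ := by
  classical
  obtain ⟨σ₁, hσ₁, hord, hterm⟩ := exists_sameMatching_ordered α ω v σ hω
  set e := pairIndexEquiv n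
  let π : Equiv.Perm (Fin n) := Tuple.sort fun i => σ₁ (e (some (i, false)))
  let g : Equiv.Perm (Option (Fin n × Bool)) :=
    Equiv.optionCongr (Equiv.prodCongrLeft fun _ => π)
  have hgn : g none = none := rfl
  have hgs : ∀ i b, g (some (i, b)) = some (π i, b) := fun _ _ => rfl
  have happ : ∀ x, (σ₁ * e.permCongr g) (e x) = σ₁ (e (g x)) := by simp
  refine ⟨σ₁ * e.permCongr g, hσ₁.trans ⟨g, ?_, happ⟩, ⟨fun i => ?_, ?_⟩, ?_⟩
  · rintro (_ | ⟨i, b⟩) <;> rfl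
  · rw [happ, happ, hgs, hgs]
    exact hord _
  · simp only [show pairIndexEquiv n = e from rfl, happ, hgs]
    refine (Tuple.monotone_sort fun i => σ₁ (e (some (i, false)))).strictMono_of_injective ?_
    intro i j hij
    simpa using e.injective (σ₁.injective hij)
  · rw [← hterm]
    unfold wedgeTerm
    simp only [show pairIndexEquiv n = e from rfl, happ, hgn, hgs]
    have hsign : Equiv.Perm.sign (σ₁ * e.permCongr g) = Equiv.Perm.sign σ₁ := by
      simp [g, Equiv.optionCongr_sign, Equiv.Perm.sign_prodCongrLeft]
    rw [hsign, Equiv.prod_comp π fun i =>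
      ω (v (σ₁ (e (some (i, false))))) (v (σ₁ (e (some (i, true)))))]

theorem wedgeTerm_swap_mul {i j : Fin (2*n+1)} (hij : i ≠ j) (hv : v i = v j) :
    wedgeTerm α ω v (Equiv.swap i j * σ) = -wedgeTerm α ω v σ := by
  have hswap : ∀ x, v (Equiv.swap i j x) = v x := by
    intro x
    rcases eq_or_ne x i with rfl | hi
    · simp [hv]
    · rcases eq_or_ne x j with rfl | hj
      · simp [hv]
      · rw [Equiv.swap_apply_of_ne_of_ne hi hj]
  simp [wedgeTerm, hswap, Equiv.Perm.sign_swap hij]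

theorem wedgeEval_eq_zero_of_eq (h2 : (2 : K) ≠ 0) (hω : ∀ x y, ω y x = -ω x y)
    {i j : Fin (2*n+1)} (hij : i ≠ j) (hv : v i = v j) : wedgeEval K n α ω v = 0 := by
  classical
  rw [wedgeEval_eq_sum_wedgeTerm]
  choose φ hφ hφc hφt using fun σ =>
    exists_sameMatching_isCanonical α ω v (Equiv.swap i j * σ) hω
  have hneg : ∀ σ, wedgeTerm α ω v (φ σ) = -wedgeTerm α ω v σ := fun σ => by
    rw [hφt, wedgeTerm_swap_mul α ω v σ hij hv]
  refine Finset.sum_involution (fun σ _ => φ σ) (fun σ _ => by rw [hneg, add_neg_cancel])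
    (fun σ _ hne heq => hne ?_) (fun σ _ => by simpa using hφc σ) (fun σ hσ => ?_)
  · have h := hneg σ
    rw [heq, eq_neg_iff_add_eq_zero, ← two_mul] at h
    exact (mul_eq_zero.1 h).resolve_left h2
  · have h := ((hφ σ).mul_left (Equiv.swap i j)).trans (hφ (φ σ))
    rw [← mul_assoc, Equiv.swap_mul_self, one_mul] at h
    exact (h.eq_of_isCanonical (by simpa using hσ) (hφc _)).symm

end Relabelling

section Linear

variable {K V : Type*} [Field K] [AddCommGroup V] [Module K V] {n : ℕ}
  (α : V →ₗ[K] K) (ω : V →ₗ[K] V →ₗ[K] K) (v : Fin (2*n+1) → V) (k : Fin (2*n+1))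

theorem exists_linearMap_wedgeTerm_update (hω : ∀ x y, ω y x = -ω x y)
    (σ : Equiv.Perm (Fin (2*n+1))) :
    ∃ L : V →ₗ[K] K,
      (∀ x, wedgeTerm (fun x => α x) (fun x y => ω x y) (Function.update v k x) σ = L x) ∧
      ∀ z, α z = 0 → (∀ y, ω z y = 0) → L z = 0 := by
  classical
  obtain ⟨y, rfl⟩ := σ.surjective k
  set e := pairIndexEquiv n with he
  obtain ⟨p, rfl⟩ := e.surjective y
  have hupd : ∀ x q, Function.update v (σ (e p)) x (σ (e q)) = if q = p then x else v (σ (e q)) := by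
    intro x q
    simp [Function.update_apply]
  simp only [wedgeTerm, ← he, hupd]
  rcases p with _ | ⟨i, b⟩
  · refine ⟨((Equiv.Perm.sign σ : ℤ) : K) • (∏ i : Fin n,
      ω (v (σ (e (some (i, false))))) (v (σ (e (some (i, true)))))) • α, fun x => ?_, ?_⟩
    · simp [mul_comm (α x)]
    · intro z hz _
      simp [hz]
  · let c : K := ∏ j ∈ Finset.univ.erase i,
      ω (v (σ (e (some (j, false))))) (v (σ (e (some (j, true)))))
    have hc : ∀ x, (∏ j ∈ Finset.univ.erase i,
        ω (if some (j, false) = some (i, b) then x else v (σ (e (some (j, false)))))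
          (if some (j, true) = some (i, b) then x else v (σ (e (some (j, true)))))) = c := by
      intro x
      refine Finset.prod_congr rfl fun j hj => ?_
      simp [Finset.ne_of_mem_erase hj]
    simp only [← Finset.mul_prod_erase Finset.univ _ (Finset.mem_univ i), hc]
    cases b
    · refine ⟨(((Equiv.Perm.sign σ : ℤ) : K) * α (v (σ (e none))) * c) •
        ω.flip (v (σ (e (some (i, true))))), fun x => ?_, fun z _ hz => ?_⟩
      · simp
        ring
      · simp [hz]
    · refine ⟨(((Equiv.Perm.sign σ : ℤ) : K) * α (v (σ (e none))) * c) •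
        ω (v (σ (e (some (i, false))))), fun x => ?_, fun z _ hz => ?_⟩
      · simp
        ring
      · simp [hω z, hz]

theorem exists_linearMap_wedgeEval_update (hω : ∀ x y, ω y x = -ω x y) :
    ∃ L : V →ₗ[K] K,
      (∀ x, wedgeEval K n (fun x => α x) (fun x y => ω x y) (Function.update v k x) = L x) ∧
      ∀ z, α z = 0 → (∀ y, ω z y = 0) → L z = 0 := by
  classical
  choose L hL hLz using exists_linearMap_wedgeTerm_update α ω v k hω
  refine ⟨∑ σ with IsCanonical σ, L σ, fun x => ?_, fun z hα hz => ?_⟩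
  · simp [wedgeEval_eq_sum_wedgeTerm, hL]
  · simp [hLz _ z hα hz]

theorem eq_zero_of_wedgeEval_ne_zero (h2 : (2 : K) ≠ 0) (hrank : Module.finrank K V = 2*n+1)
    (hω : ∀ x y, ω y x = -ω x y)
    (hv : wedgeEval K n (fun x => α x) (fun x y => ω x y) v ≠ 0)
    {x : V} (hαx : α x = 0) (hωx : ∀ y, ω x y = 0) : x = 0 := by
  classical
  have coeff_eq_zero : ∀ c : Fin (2*n+1) → K, α (∑ j, c j • v j) = 0 →
      (∀ y, ω (∑ j, c j • v j) y = 0) → ∀ k, c k = 0 := by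
    intro c hα hz k
    obtain ⟨L, hL, hLz⟩ := exists_linearMap_wedgeEval_update α ω v k hω
    have h := hLz _ hα hz
    rw [map_sum, Finset.sum_eq_single k] at h
    · rw [map_smul, ← hL, Function.update_eq_self, smul_eq_mul] at h
      exact (mul_eq_zero.1 h).resolve_right hv
    · intro j _ hjk
      rw [map_smul, ← hL, wedgeEval_eq_zero_of_eq _ _ _ h2 hω hjk (by simp [hjk]), smul_zero]
    · simp
  have hli : LinearIndependent K v :=
    Fintype.linearIndependent_iff.2 fun c hc => coeff_eq_zero c (by simp [hc]) (by simp [hc])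
  have : FiniteDimensional K V := Module.finite_of_finrank_eq_succ hrank
  have hspan := hli.span_eq_top_of_card_eq_finrank' (by simp [hrank])
  obtain ⟨c, rfl⟩ := (Submodule.mem_span_range_iff_exists_fun K).1
    (hspan ▸ Submodule.mem_top : x ∈ Submodule.span K (Set.range v))
  simp [coeff_eq_zero c hαx hωx]

end Linear

/-- In a cosymplectic Jacobi–Jordan algebra `(J,·,α,ω)` with Reeb vector `ξ`,
one has `ξ·ξ = 0`. -/
theorem stmt6 {K V : Type*} [Field K] [AddCommGroup V] [Module K V]
    [FiniteDimensional K V] (h2 : (2 : K) ≠ 0) (h3 : (3 : K) ≠ 0)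
    (n : ℕ) (hrank : Module.finrank K V = 2*n+1)
    (m : V →ₗ[K] V →ₗ[K] V)
    (hcomm : ∀ x y, m x y = m y x)
    (hjac : ∀ x y z, m x (m y z) + m y (m z x) + m z (m x y) = 0)
    (α : V →ₗ[K] K) (ω : V →ₗ[K] V →ₗ[K] K)
    (halt : ∀ x, ω x x = 0)
    (hwedge : ∃ v, wedgeEval K n (fun x => α x) (fun x y => ω x y) v ≠ 0)
    (hαcl : ∀ x y, α (m x y) = 0)
    (hωcl : ∀ x y z, ω (m x y) z + ω (m z x) y + ω (m y z) x = 0)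
    (ξ : V) (hξ1 : α ξ = 1) (hξ0 : ∀ y, ω ξ y = 0)
    : m ξ ξ = 0 := by
  have hω : ∀ x y, ω y x = -ω x y := fun x y => by
    have h := halt (x + y)
    simp only [map_add, LinearMap.add_apply, halt, zero_add, add_zero] at h
    exact eq_neg_of_add_eq_zero_left h
  obtain ⟨v, hv⟩ := hwedge
  refine eq_zero_of_wedgeEval_ne_zero α ω v h2 hrank hω hv (hαcl ξ ξ) fun y => ?_
  simpa [hω ξ, hξ0] using hωcl ξ ξ y
end

section
/- Let (J, ·, α, ω) be a cosymplectic Jacobi–Jordan algebra of dimension 2n+1. Then h = ker(α) is an ideal of J (indeed J·J ⊆ h), and the restriction ω_h of ω to h × h is non-degenerate, so that (h, ·, ω_h) is a symplectic Jacobi–Jordan algebra of dimension 2n. -/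
namespace Cosymplectic

open Equiv

variable {K V : Type*} [Field K] {n : ℕ}

/-- The position of the argument of `α` (`none`) and of the first (`false`) and second (`true`)
argument of the `i`-th copy of `ω` in `α ∧ ωⁿ`. -/
def slotFun (n : ℕ) : Option (Fin n × Bool) → Fin (2 * n + 1)
  | none => ⟨0, by omega⟩
  | some (i, false) => ⟨2 * (i : ℕ) + 1, by have := i.2; omega⟩
  | some (i, true) => ⟨2 * (i : ℕ) + 2, by have := i.2; omega⟩

lemma slotFun_injective : Function.Injective (slotFun n) := by
  rintro (_ | ⟨i, _ | _⟩) (_ | ⟨j, _ | _⟩) h <;> simp only [slotFun, Fin.mk.injEq] at h <;>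
    first
    | rfl
    | (exfalso; omega)
    | (have : i = j := Fin.ext (by omega)
       rw [this])

/-- The positions of the arguments of `α ∧ ωⁿ`, as a bijection. -/
noncomputable def slot (n : ℕ) : Option (Fin n × Bool) ≃ Fin (2 * n + 1) :=
  Equiv.ofBijective (slotFun n) <| (Fintype.bijective_iff_injective_and_card _).2
    ⟨slotFun_injective, by simp; ring⟩

/-- The summand of `wedgeEval` indexed by `σ`. -/
noncomputable def term (α : V → K) (ω : V → V → K) (v : Fin (2 * n + 1) → V)
    (σ : Perm (Fin (2 * n + 1))) : K :=
  (Perm.sign σ : ℤ) • (α (v (σ (slot n none))) *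
    ∏ i : Fin n, ω (v (σ (slot n (some (i, false))))) (v (σ (slot n (some (i, true))))))

/-- The canonical representatives over which `wedgeEval` sums. -/
structure IsCanonical (σ : Perm (Fin (2 * n + 1))) : Prop where
  lt : ∀ i : Fin n, σ (slot n (some (i, false))) < σ (slot n (some (i, true)))
  strictMono : StrictMono fun i : Fin n => σ (slot n (some (i, false)))

open Classical in
lemma wedgeEval_eq (α : V → K) (ω : V → V → K) (v : Fin (2 * n + 1) → V) :
    wedgeEval K n α ω v = ∑ σ with IsCanonical σ, term α ω v σ := by
  unfold wedgeEval
  refine Finset.sum_congr (Finset.filter_congr fun σ _ => ?_) fun σ _ => rfl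
  exact ⟨fun h => ⟨h.1, fun i j => h.2 i j⟩, fun h => ⟨h.lt, fun i j hij => h.strictMono hij⟩⟩

/-- The involution of the positions exchanging the two arguments of every copy of `ω`. -/
noncomputable def slotSwap (n : ℕ) : Perm (Fin (2 * n + 1)) :=
  (slot n).permCongr (optionCongr (prodCongrRight fun _ => swap false true))

@[simp] lemma slotSwap_none : slotSwap n (slot n none) = slot n none := by
  simp [slotSwap, permCongr_apply]

@[simp] lemma slotSwap_false (i : Fin n) :
    slotSwap n (slot n (some (i, false))) = slot n (some (i, true)) := by
  simp [slotSwap, permCongr_apply]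

@[simp] lemma slotSwap_true (i : Fin n) :
    slotSwap n (slot n (some (i, true))) = slot n (some (i, false)) := by
  simp [slotSwap, permCongr_apply]

/-- The matching of the arguments determined by `σ`, as an involution. -/
noncomputable def matching (σ : Perm (Fin (2 * n + 1))) : Perm (Fin (2 * n + 1)) :=
  σ * slotSwap n * σ⁻¹

@[simp] lemma matching_apply (σ : Perm (Fin (2 * n + 1))) (x : Fin (2 * n + 1)) :
    matching σ (σ x) = σ (slotSwap n x) := by
  simp [matching]

lemma matching_mul (τ σ : Perm (Fin (2 * n + 1))) :
    matching (τ * σ) = τ * matching σ * τ⁻¹ := by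
  simp [matching, mul_assoc]

lemma exists_slot (σ : Perm (Fin (2 * n + 1))) (x : Fin (2 * n + 1)) :
    ∃ s, σ (slot n s) = x :=
  ⟨(slot n).symm (σ.symm x), by simp⟩

lemma matching_eq_self_iff (σ : Perm (Fin (2 * n + 1))) (x : Fin (2 * n + 1)) :
    matching σ x = x ↔ x = σ (slot n none) := by
  obtain ⟨_ | ⟨i, _ | _⟩, rfl⟩ := exists_slot σ x <;> simp

lemma IsCanonical.range_eq {σ : Perm (Fin (2 * n + 1))} (hσ : IsCanonical σ) :
    (Set.range fun i : Fin n => σ (slot n (some (i, false)))) = {x | x < matching σ x} := by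
  ext x
  obtain ⟨_ | ⟨i, _ | _⟩, rfl⟩ := exists_slot σ x
  · simp
  · simp [hσ.lt i]
  · simp [(hσ.lt i).le]

lemma IsCanonical.matching_inj {σ ρ : Perm (Fin (2 * n + 1))} (hσ : IsCanonical σ)
    (hρ : IsCanonical ρ) (h : matching σ = matching ρ) : σ = ρ := by
  have hfst := (hσ.strictMono.range_inj hρ.strictMono).1 (by rw [hσ.range_eq, hρ.range_eq, h])
  have key : ∀ s, σ (slot n s) = ρ (slot n s) := by
    rintro (_ | ⟨i, _ | _⟩)
    · rw [← matching_eq_self_iff, ← h, matching_eq_self_iff]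
    · exact congrFun hfst i
    · have := congrArg (matching σ) (congrFun hfst i)
      simp only [matching_apply, slotSwap_false] at this
      rw [this, h, matching_apply, slotSwap_false]
  ext x : 1
  simpa using key ((slot n).symm x)

lemma prod_sign_smul {ι : Type*} [Fintype ι] (s : ι → ℤˣ) (f : ι → K) :
    ((∏ i, s i : ℤˣ) : ℤ) • ∏ i, f i = ∏ i, ((s i : ℤˣ) : ℤ) • f i := by
  simp [zsmul_eq_mul, Finset.prod_mul_distrib]

/-- Exchanging the arguments of some copies of `ω`. -/
lemma exists_flip (α : V → K) {ω : V → V → K} (hω : ∀ x y, ω x y = -ω y x)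
    (v : Fin (2 * n + 1) → V) (σ : Perm (Fin (2 * n + 1))) :
    ∃ ρ, matching ρ = matching σ ∧ term α ω v ρ = term α ω v σ ∧
      ∀ i, ρ (slot n (some (i, false))) < ρ (slot n (some (i, true))) := by
  classical
  let ε : Fin n → Perm Bool := fun i =>
    if σ (slot n (some (i, false))) < σ (slot n (some (i, true))) then 1 else swap false true
  let h : Perm (Fin (2 * n + 1)) := (slot n).permCongr (optionCongr (prodCongrRight ε))
  have h_none : h (slot n none) = slot n none := by simp [h, permCongr_apply]
  have h_some (i b) : h (slot n (some (i, b))) = slot n (some (i, ε i b)) := by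
    simp [h, permCongr_apply]
  have h_sign : Perm.sign h = ∏ i, Perm.sign (ε i) := by
    simp only [h, Perm.sign_permCongr, optionCongr_sign, Perm.sign_prodCongrRight]
  have hcomm : h * slotSwap n = slotSwap n * h := by
    ext x : 1
    obtain ⟨s, rfl⟩ := (slot n).surjective x
    rcases s with _ | ⟨i, _ | _⟩
    · simp [h_none]
    all_goals
      simp only [Perm.mul_apply, slotSwap_false, slotSwap_true, h_some, ε]
      split_ifs <;> simp
  refine ⟨σ * h, ?_, ?_, fun i => ?_⟩
  · simp only [matching, mul_inv_rev, mul_assoc]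
    rw [← mul_assoc h, hcomm]
    simp [mul_assoc]
  · simp only [term, Perm.mul_apply, h_none, h_some, Perm.sign_mul, h_sign, Units.val_mul, mul_smul]
    rw [← mul_smul_comm, prod_sign_smul]
    congr 2
    refine Finset.prod_congr rfl fun i _ => ?_
    simp only [ε]
    split_ifs
    · simp
    · simp [← hω]
  · simp only [Perm.mul_apply, h_some, ε]
    split_ifs with hi
    · simpa using hi
    · refine lt_of_le_of_ne (by simpa using hi) ?_
      simp

/-- Permuting the copies of `ω`. -/
lemma exists_permute (α : V → K) (ω : V → V → K) (v : Fin (2 * n + 1) → V)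
    (σ : Perm (Fin (2 * n + 1))) (π : Perm (Fin n)) :
    ∃ ρ, matching ρ = matching σ ∧ term α ω v ρ = term α ω v σ ∧
      ∀ i b, ρ (slot n (some (i, b))) = σ (slot n (some (π i, b))) := by
  let h : Perm (Fin (2 * n + 1)) := (slot n).permCongr (optionCongr (prodCongrLeft fun _ => π))
  have h_none : h (slot n none) = slot n none := by simp [h, permCongr_apply]
  have h_some (i b) : h (slot n (some (i, b))) = slot n (some (π i, b)) := by
    simp [h, permCongr_apply]
  have h_sign : Perm.sign h = 1 := by
    simp only [h, Perm.sign_permCongr, optionCongr_sign, Perm.sign_prodCongrLeft]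
    simp
  have hcomm : h * slotSwap n = slotSwap n * h := by
    ext x : 1
    obtain ⟨s, rfl⟩ := (slot n).surjective x
    rcases s with _ | ⟨i, _ | _⟩ <;> simp [h_none, h_some]
  refine ⟨σ * h, ?_, ?_, fun i b => by simp [h_some]⟩
  · simp only [matching, mul_inv_rev, mul_assoc]
    rw [← mul_assoc h, hcomm]
    simp [mul_assoc]
  · simp only [term, Perm.mul_apply, h_none, h_some, Perm.sign_mul, h_sign, mul_one]
    rw [Equiv.prod_comp π fun i => ω (v (σ (slot n (some (i, false)))))
      (v (σ (slot n (some (i, true)))))]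

lemma exists_isCanonical (α : V → K) {ω : V → V → K} (hω : ∀ x y, ω x y = -ω y x)
    (v : Fin (2 * n + 1) → V) (σ : Perm (Fin (2 * n + 1))) :
    ∃ ρ, IsCanonical ρ ∧ matching ρ = matching σ ∧ term α ω v ρ = term α ω v σ := by
  obtain ⟨σ', hm', ht', hlt⟩ := exists_flip α hω v σ
  let f : Fin n → Fin (2 * n + 1) := fun i => σ' (slot n (some (i, false)))
  have hf : Function.Injective f := fun i j hij => by simpa [f] using hij
  obtain ⟨ρ, hm, ht, hρ⟩ := exists_permute α ω v σ' (Tuple.sort f)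
  refine ⟨ρ, ⟨fun i => ?_, ?_⟩, hm.trans hm', ht.trans ht'⟩
  · simpa only [hρ] using hlt _
  · simpa only [hρ, f, Function.comp_def] using
      (Tuple.monotone_sort f).strictMono_of_injective (hf.comp (Tuple.sort f).injective)

lemma term_swap_mul (α : V → K) (ω : V → V → K) {v : Fin (2 * n + 1) → V}
    {a b : Fin (2 * n + 1)} (hab : a ≠ b) (hv : v a = v b) (σ : Perm (Fin (2 * n + 1))) :
    term α ω v (swap a b * σ) = -term α ω v σ := by
  have hvs (x) : v (swap a b x) = v x := by
    rw [swap_apply_def]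
    split_ifs <;> simp [*]
  simp [term, hvs, Perm.sign_swap hab]

lemma term_eq_zero_of_matching (α : V → K) {ω : V → V → K} (hω : ∀ x y, ω x y = -ω y x)
    {v : Fin (2 * n + 1) → V} {σ : Perm (Fin (2 * n + 1))} {a b : Fin (2 * n + 1)}
    (hv : ω (v a) (v b) = 0) (hab : a ≠ b) (h : matching σ a = b) : term α ω v σ = 0 := by
  obtain ⟨_ | ⟨i, _ | _⟩, rfl⟩ := exists_slot σ a
  · simp at h
    exact absurd h hab
  all_goals
    simp only [matching_apply, slotSwap_false, slotSwap_true] at h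
    subst h
    rw [term, Finset.prod_eq_zero (Finset.mem_univ i)]
    · simp
    · first
      | exact hv
      | rw [hω, hv, neg_zero]

/-- `wedgeEval` is alternating. -/
lemma wedgeEval_eq_zero (α : V → K) {ω : V → V → K} (hω : ∀ x y, ω x y = -ω y x)
    (halt : ∀ x, ω x x = 0) {v : Fin (2 * n + 1) → V}
    {a b : Fin (2 * n + 1)} (hab : a ≠ b) (hv : v a = v b) : wedgeEval K n α ω v = 0 := by
  classical
  rw [wedgeEval_eq]
  choose c hc hcm hct using exists_isCanonical α hω v
  refine Finset.sum_involution (fun σ _ => c (swap a b * σ)) (fun σ _ => ?_) (fun σ _ h₀ h => h₀ ?_)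
    (fun σ _ => by simp [hc]) (fun σ hσ => ?_)
  · rw [hct, term_swap_mul α ω hab hv, add_neg_cancel]
  · have hm : matching σ a = swap a b (matching σ b) := by
      conv_lhs => rw [← h, hcm, matching_mul]
      simp
    by_cases hb : matching σ a = b
    · exact term_eq_zero_of_matching α hω (by rw [hv, halt]) hab hb
    · rw [swap_apply_def] at hm
      split_ifs at hm with h₁ h₂
      · exact absurd hm hb
      · exact absurd (((matching_eq_self_iff σ a).1 hm).trans
          ((matching_eq_self_iff σ b).1 h₂).symm) hab
      · exact absurd ((matching σ).injective hm) hab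
  · refine (hc _).matching_inj (by simpa using hσ) ?_
    rw [hcm, matching_mul, hcm, matching_mul]
    simp [mul_assoc]

section Linear

variable [AddCommGroup V] [Module K V]

lemma exists_term_update_eq (α : V →ₗ[K] K) (ω : V →ₗ[K] V →ₗ[K] K) (v : Fin (2 * n + 1) → V)
    (j : Fin (2 * n + 1)) (σ : Perm (Fin (2 * n + 1))) :
    ∃ L : V →ₗ[K] K, ∀ x,
      term (fun x => α x) (fun x y => ω x y) (Function.update v j x) σ = L x := by
  have hne (i : Fin n) (b : Bool) (x : V) :
      ∏ k ∈ Finset.univ.erase i,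
        ω (Function.update v (σ (slot n (some (i, b)))) x (σ (slot n (some (k, false)))))
          (Function.update v (σ (slot n (some (i, b)))) x (σ (slot n (some (k, true))))) =
      ∏ k ∈ Finset.univ.erase i,
        ω (v (σ (slot n (some (k, false))))) (v (σ (slot n (some (k, true))))) :=
    Finset.prod_congr rfl fun k hk => by simp [Finset.ne_of_mem_erase hk]
  obtain ⟨_ | ⟨i, _ | _⟩, rfl⟩ := exists_slot σ j
  · refine ⟨(Perm.sign σ : ℤ) • (∏ i : Fin n,
      ω (v (σ (slot n (some (i, false))))) (v (σ (slot n (some (i, true)))))) • α, fun x => ?_⟩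
    simp [term, mul_comm]
  · refine ⟨(Perm.sign σ : ℤ) • (α (v (σ (slot n none))) * ∏ k ∈ Finset.univ.erase i,
      ω (v (σ (slot n (some (k, false))))) (v (σ (slot n (some (k, true)))))) •
        ω.flip (v (σ (slot n (some (i, true))))), fun x => ?_⟩
    rw [term, ← Finset.mul_prod_erase _ _ (Finset.mem_univ i), hne]
    simp
    exact .inl (by ring)
  · refine ⟨(Perm.sign σ : ℤ) • (α (v (σ (slot n none))) * ∏ k ∈ Finset.univ.erase i,
      ω (v (σ (slot n (some (k, false))))) (v (σ (slot n (some (k, true)))))) •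
        ω (v (σ (slot n (some (i, false))))), fun x => ?_⟩
    rw [term, ← Finset.mul_prod_erase _ _ (Finset.mem_univ i), hne]
    simp
    exact .inl (by ring)

lemma exists_wedgeEval_update_eq (α : V →ₗ[K] K) (ω : V →ₗ[K] V →ₗ[K] K)
    (v : Fin (2 * n + 1) → V) (j : Fin (2 * n + 1)) :
    ∃ L : V →ₗ[K] K, ∀ x,
      wedgeEval K n (fun x => α x) (fun x y => ω x y) (Function.update v j x) = L x := by
  classical
  choose L hL using exists_term_update_eq α ω v j
  exact ⟨∑ σ with IsCanonical σ, L σ, fun x => by simp [wedgeEval_eq, hL]⟩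

/-- `α ∧ ωⁿ` as an alternating map. -/
noncomputable def wedge (n : ℕ) (α : V →ₗ[K] K) (ω : V →ₗ[K] V →ₗ[K] K) (hω : ω.IsAlt) :
    V [⋀^Fin (2 * n + 1)]→ₗ[K] K where
  toFun := wedgeEval K n (fun x => α x) (fun x y => ω x y)
  map_update_add' {inst} v j x y := by
    rw [Subsingleton.elim inst (instDecidableEqFin _)]
    obtain ⟨L, hL⟩ := exists_wedgeEval_update_eq α ω v j
    simp only [hL, map_add]
  map_update_smul' {inst} v j c x := by
    rw [Subsingleton.elim inst (instDecidableEqFin _)]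
    obtain ⟨L, hL⟩ := exists_wedgeEval_update_eq α ω v j
    simp only [hL, map_smul]
  map_eq_zero_of_eq' v i j hv hij :=
    wedgeEval_eq_zero _ (fun x y => (hω.neg y x).symm) hω hij hv

lemma exists_basis [FiniteDimensional K V] {d : ℕ} {α : V →ₗ[K] K} (hα : α ≠ 0)
    (hker : Module.finrank K (LinearMap.ker α) = d) {x : V} (hx : α x = 0) (hx₀ : x ≠ 0) :
    ∃ b : Module.Basis (Fin (d + 1)) K V,
      (∀ j, j ≠ 0 → α (b j) = 0) ∧ ∃ j, j ≠ 0 ∧ b j = x := by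
  obtain ⟨e, he⟩ : ∃ e, α e ≠ 0 := by
    by_contra! h
    exact hα (LinearMap.ext h)
  let x' : LinearMap.ker α := ⟨x, hx⟩
  have hli : LinearIndepOn K id ({x'} : Set (LinearMap.ker α)) :=
    LinearIndepOn.singleton (by simpa [x', Subtype.ext_iff] using hx₀)
  let b₀ := Module.Basis.extend hli
  have := Module.Finite.finite_basis b₀
  have := Fintype.ofFinite (hli.extend (Set.subset_univ _))
  let ε := Fintype.equivFinOfCardEq ((Module.finrank_eq_card_basis b₀).symm.trans hker)
  let b₁ := b₀.reindex ε
  let b := Module.Basis.mkFinCons e b₁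
    (fun c y hy hc => by
      have := congrArg α hc
      rw [map_add, map_smul, LinearMap.mem_ker.1 hy] at this
      simpa [he] using this)
    (fun z => ⟨-(α z / α e), by simp [he]⟩)
  have hb : ⇑b = Fin.cons e ((↑) ∘ b₁) := Module.Basis.coe_mkFinCons ..
  refine ⟨b, fun j hj => ?_, (ε ⟨x', hli.subset_extend _ rfl⟩).succ, Fin.succ_ne_zero _, ?_⟩
  · obtain ⟨k, rfl⟩ := Fin.exists_succ_eq.2 hj
    simp [hb]
  · simp [hb, b₁, b₀, x']

/-- If `α ∧ ωⁿ ≠ 0` on a `(2n+1)`-dimensional space then `ω` is non-degenerate on `ker α`. -/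
lemma eq_zero_of_wedge_ne_zero [FiniteDimensional K V] {α : V →ₗ[K] K} {ω : V →ₗ[K] V →ₗ[K] K}
    (hω : ω.IsAlt) (hα : α ≠ 0) (hker : Module.finrank K (LinearMap.ker α) = 2 * n)
    (hw : wedge n α ω hω ≠ 0) {x : V} (hx : α x = 0) (hxω : ∀ y, α y = 0 → ω x y = 0) : x = 0 := by
  classical
  by_contra hx₀
  obtain ⟨b, hb, j, hj, rfl⟩ := exists_basis hα hker hx hx₀
  refine hw ?_
  rw [(wedge n α ω hω).eq_smul_basis_det b]
  suffices h : wedgeEval K n (fun x => α x) (fun x y => ω x y) b = 0 by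
    change wedgeEval K n (fun x => α x) (fun x y => ω x y) b • _ = _
    rw [h, zero_smul]
  rw [wedgeEval_eq]
  refine Finset.sum_eq_zero fun σ _ => ?_
  by_cases h₀ : σ (slot n none) = 0
  · have hm : matching σ j ≠ j := by rwa [Ne, matching_eq_self_iff, h₀]
    refine term_eq_zero_of_matching _ (fun x y => (hω.neg y x).symm) (hxω _ (hb _ ?_)) hm.symm rfl
    intro h
    obtain ⟨_ | ⟨i, _ | _⟩, rfl⟩ := exists_slot σ j
    · exact hj h₀
    all_goals
      rw [matching_apply, ← h₀] at h
      simp at h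
  · simp [term, hb _ h₀]

end Linear

end Cosymplectic

/-- In a `(2n+1)`-dimensional cosymplectic JJ-algebra `(J,·,α,ω)`,
`h = ker α` is an ideal (indeed `J·J ⊆ h`), `dim h = 2n`, and the restriction of `ω`
to `h` is non-degenerate, so that `(h,·,ω_h)` is a `2n`-dimensional symplectic
JJ-algebra (the JJ axioms and the closedness of `ω_h` holding on `h` by restriction). -/
theorem stmt8 {K V : Type*} [Field K] [AddCommGroup V] [Module K V]
    [FiniteDimensional K V] (h2 : (2 : K) ≠ 0) (h3 : (3 : K) ≠ 0)
    (n : ℕ) (hrank : Module.finrank K V = 2*n+1)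
    (m : V →ₗ[K] V →ₗ[K] V)
    (hcomm : ∀ x y, m x y = m y x)
    (hjac : ∀ x y z, m x (m y z) + m y (m z x) + m z (m x y) = 0)
    (α : V →ₗ[K] K) (ω : V →ₗ[K] V →ₗ[K] K)
    (halt : ∀ x, ω x x = 0)
    (hwedge : ∃ v, wedgeEval K n (fun x => α x) (fun x y => ω x y) v ≠ 0)
    (hαcl : ∀ x y, α (m x y) = 0)
    (hωcl : ∀ x y z, ω (m x y) z + ω (m z x) y + ω (m y z) x = 0)
    : (∀ x y : V, α (m x y) = 0) ∧
      (Module.finrank K (LinearMap.ker α) = 2*n) ∧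
      (∀ x, α x = 0 → (∀ y, α y = 0 → ω x y = 0) → x = 0) ∧
      (∀ x y, α x = 0 → α y = 0 → α (m x y) = 0) ∧
      (∀ x y z, α x = 0 → α y = 0 → α z = 0 →
        ω (m x y) z + ω (m z x) y + ω (m y z) x = 0) := by
  have hω : ω.IsAlt := halt
  obtain ⟨v, hv⟩ := hwedge
  have hα : α ≠ 0 := by
    rintro rfl
    exact hv (by simp [wedgeEval])
  have hker : Module.finrank K (LinearMap.ker α) = 2 * n := by
    have := Module.Dual.finrank_ker_add_one_of_ne_zero hα
    omega
  have hw : Cosymplectic.wedge n α ω hω ≠ 0 := fun h => hv (DFunLike.congr_fun h v)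
  exact ⟨hαcl, hker, fun x hx hxω => Cosymplectic.eq_zero_of_wedge_ne_zero hω hα hker hw hx hxω,
    fun x y _ _ => hαcl x y, fun x y z _ _ _ => hωcl x y z⟩
end

section
/- Let (J, ·, α, ω) be a cosymplectic Jacobi–Jordan algebra with Reeb vector ξ, let h = ker(α) with the non-degenerate form ω_h = ω|_{h×h}, and let ⊙ be the right-skew-symmetric product on h determined by ω_h(x⊙y, z) = ω_h(x, y·z) for all x, y, z ∈ h. Then the map D_ξ : h → h, x ↦ ξ·x (which maps h into h since J·J ⊆ ker α) is an anti-derivation of (h,⊙): D_ξ(x⊙y) = −D_ξ(x)⊙y − x⊙D_ξ(y) for all x, y ∈ h. -/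
namespace WedgeEval

open Equiv

variable {n : ℕ}

/-- The first position of the `i`-th pair. -/
def fstPos (i : Fin n) : Fin (2*n+1) := ⟨2*(i:ℕ)+1, by have := i.2; omega⟩

/-- The second position of the `i`-th pair. -/
def sndPos (i : Fin n) : Fin (2*n+1) := ⟨2*(i:ℕ)+2, by have := i.2; omega⟩

@[simp] lemma fstPos_inj {i j : Fin n} : fstPos i = fstPos j ↔ i = j := by
  simp only [fstPos, Fin.ext_iff]; omega

@[simp] lemma sndPos_inj {i j : Fin n} : sndPos i = sndPos j ↔ i = j := by
  simp only [sndPos, Fin.ext_iff]; omega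

@[simp] lemma fstPos_ne_sndPos (i j : Fin n) : fstPos i ≠ sndPos j := by
  simp only [fstPos, sndPos, ne_eq, Fin.ext_iff]; omega

@[simp] lemma sndPos_ne_fstPos (i j : Fin n) : sndPos i ≠ fstPos j :=
  (fstPos_ne_sndPos j i).symm

@[simp] lemma fstPos_ne_zero (i : Fin n) : fstPos i ≠ 0 := by
  simp [fstPos, Fin.ext_iff]

@[simp] lemma sndPos_ne_zero (i : Fin n) : sndPos i ≠ 0 := by
  simp [sndPos, Fin.ext_iff]

@[simp] lemma zero_ne_fstPos (i : Fin n) : 0 ≠ fstPos i := (fstPos_ne_zero i).symm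

@[simp] lemma zero_ne_sndPos (i : Fin n) : 0 ≠ sndPos i := (sndPos_ne_zero i).symm

lemma pos_cases (k : Fin (2*n+1)) :
    k = 0 ∨ (∃ i : Fin n, k = fstPos i) ∨ ∃ i : Fin n, k = sndPos i := by
  obtain ⟨k, hk⟩ := k
  simp only [fstPos, sndPos, Fin.ext_iff, Fin.val_zero]
  rcases Nat.eq_zero_or_pos k with h | h
  · exact Or.inl h
  · rcases Nat.mod_two_eq_zero_or_one k with h' | h'
    · exact Or.inr (Or.inr ⟨⟨k / 2 - 1, by omega⟩, by simp only; omega⟩)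
    · exact Or.inr (Or.inl ⟨⟨k / 2, by omega⟩, by simp only; omega⟩)

/-- The other position of the pair containing `k`; the unpaired position `0` is its own partner. -/
def partnerFun (k : Fin (2*n+1)) : Fin (2*n+1) :=
  if h : (k : ℕ) = 0 then k
  else if h' : (k : ℕ) % 2 = 1 then ⟨k + 1, by omega⟩ else ⟨k - 1, by omega⟩

lemma partnerFun_zero : partnerFun (0 : Fin (2*n+1)) = 0 := by simp [partnerFun]

lemma partnerFun_fstPos (i : Fin n) : partnerFun (fstPos i) = sndPos i := by
  simp [partnerFun, fstPos, sndPos]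

lemma partnerFun_sndPos (i : Fin n) : partnerFun (sndPos i) = fstPos i := by
  simp [partnerFun, fstPos, sndPos]

/-- The involution exchanging the two positions of each pair. -/
def partner (n : ℕ) : Perm (Fin (2*n+1)) :=
  Function.Involutive.toPerm partnerFun fun k => by
    rcases pos_cases k with rfl | ⟨i, rfl⟩ | ⟨i, rfl⟩ <;>
      simp [partnerFun_zero, partnerFun_fstPos, partnerFun_sndPos]

@[simp] lemma partner_zero : partner n 0 = 0 := partnerFun_zero

@[simp] lemma partner_fstPos (i : Fin n) : partner n (fstPos i) = sndPos i := partnerFun_fstPos i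

@[simp] lemma partner_sndPos (i : Fin n) : partner n (sndPos i) = fstPos i := partnerFun_sndPos i

/-- The transposition of the two positions of the `i`-th pair. -/
def flip (i : Fin n) : Perm (Fin (2*n+1)) := swap (fstPos i) (sndPos i)

/-- The permutation exchanging the `i`-th and the `j`-th pair. -/
def pairSwap (i j : Fin n) : Perm (Fin (2*n+1)) :=
  swap (fstPos i) (fstPos j) * swap (sndPos i) (sndPos j)

lemma flip_zero (i : Fin n) : flip i 0 = 0 := by
  simp [flip, swap_apply_of_ne_of_ne]

lemma flip_fstPos (i j : Fin n) : flip i (fstPos j) = if j = i then sndPos j else fstPos j := by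
  simp only [flip, swap_apply_def, fstPos_inj, fstPos_ne_sndPos, if_false]
  split_ifs with h <;> simp [h]

lemma flip_sndPos (i j : Fin n) : flip i (sndPos j) = if j = i then fstPos j else sndPos j := by
  simp only [flip, swap_apply_def, sndPos_inj, sndPos_ne_fstPos, if_false]
  split_ifs with h <;> simp [h]

lemma pairSwap_zero (i j : Fin n) : pairSwap i j 0 = 0 := by
  simp [pairSwap, swap_apply_of_ne_of_ne]

lemma pairSwap_fstPos (i j k : Fin n) : pairSwap i j (fstPos k) = fstPos (swap i j k) := by
  simp only [pairSwap, Perm.mul_apply, swap_apply_def, fstPos_inj, fstPos_ne_sndPos, if_false]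
  split_ifs <;> rfl

lemma pairSwap_sndPos (i j k : Fin n) : pairSwap i j (sndPos k) = sndPos (swap i j k) := by
  simp only [pairSwap, Perm.mul_apply, swap_apply_def, sndPos_inj]
  split_ifs <;> simp_all

/-- The group of symmetries of the pairing of positions. -/
def pairSymm (n : ℕ) : Subgroup (Perm (Fin (2*n+1))) :=
  Subgroup.closure {h | (∃ i : Fin n, h = flip i) ∨ ∃ i j : Fin n, i ≠ j ∧ h = pairSwap i j}

lemma flip_mem (i : Fin n) : flip i ∈ pairSymm n := Subgroup.subset_closure (Or.inl ⟨i, rfl⟩)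

lemma pairSwap_mem {i j : Fin n} (h : i ≠ j) : pairSwap i j ∈ pairSymm n :=
  Subgroup.subset_closure (Or.inr ⟨i, j, h, rfl⟩)

lemma partner_apply_comm {h : Perm (Fin (2*n+1))} (hh : h ∈ pairSymm n) (k : Fin (2*n+1)) :
    partner n (h k) = h (partner n k) := by
  suffices h ∈ Subgroup.centralizer {partner n} by
    have := Subgroup.mem_centralizer_singleton_iff.1 this
    exact (DFunLike.congr_fun this k).symm
  refine (Subgroup.closure_le _).2 ?_ hh
  rintro h (⟨i, rfl⟩ | ⟨i, j, -, rfl⟩) <;>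
  · refine Subgroup.mem_centralizer_singleton_iff.2 (Equiv.ext fun k => ?_)
    rcases pos_cases k with rfl | ⟨l, rfl⟩ | ⟨l, rfl⟩ <;>
      simp only [Perm.mul_apply, flip_zero, flip_fstPos, flip_sndPos, pairSwap_zero,
        pairSwap_fstPos, pairSwap_sndPos, partner_zero, partner_fstPos, partner_sndPos] <;>
      split_ifs <;> simp

/-- The permutations listing each pair increasingly and the pairs by increasing first element. -/
def IsCanonical (σ : Perm (Fin (2*n+1))) : Prop :=
  (∀ i : Fin n, σ (fstPos i) < σ (sndPos i)) ∧
    ∀ i j : Fin n, i < j → σ (fstPos i) < σ (fstPos j)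

lemma exists_isCanonical (σ : Perm (Fin (2*n+1))) :
    ∃ h ∈ pairSymm n, IsCanonical (σ * h) := by
  obtain ⟨⟨h, hh⟩, hmin⟩ := Finite.exists_min (fun h : pairSymm n =>
    ∑ i : Fin n, (n - i : ℤ) * (((σ * (h : Perm (Fin (2*n+1)))) (fstPos i) : ℕ) : ℤ))
  refine ⟨h, hh, fun i => ?_, fun i j hij => ?_⟩
  · by_contra hlt
    refine absurd (hmin ⟨h * flip i, mul_mem hh (flip_mem i)⟩) (not_le.2 ?_)
    have hne : (σ * h) (sndPos i) ≠ (σ * h) (fstPos i) := by simp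
    have hlt' := lt_of_le_of_ne (not_lt.1 hlt) hne
    refine Finset.sum_lt_sum (fun k _ => ?_) ⟨i, Finset.mem_univ _, ?_⟩
    · have : (0 : ℤ) ≤ n - k := by have := k.2; omega
      refine mul_le_mul_of_nonneg_left ?_ this
      simp only [← mul_assoc]
      rw [Perm.mul_apply (σ * h), flip_fstPos]
      split_ifs with hk
      · subst hk; exact_mod_cast hlt'.le
      · rfl
    · have : (0 : ℤ) < n - i := by have := i.2; omega
      refine mul_lt_mul_of_pos_left ?_ this
      simp only [← mul_assoc]
      rw [Perm.mul_apply (σ * h), flip_fstPos, if_pos rfl]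
      exact_mod_cast hlt'
  · by_contra hlt
    refine absurd (hmin ⟨h * pairSwap i j, mul_mem hh (pairSwap_mem hij.ne)⟩) (not_le.2 ?_)
    have hne : (σ * h) (fstPos j) ≠ (σ * h) (fstPos i) := by simp [hij.ne']
    have hlt' : (((σ * h) (fstPos j) : ℕ) : ℤ) < ((σ * h) (fstPos i) : ℕ) := by
      exact_mod_cast lt_of_le_of_ne (not_lt.1 hlt) hne
    have hij' : ((i : ℕ) : ℤ) < (j : ℕ) := by exact_mod_cast hij
    simp only [← mul_assoc]
    simp only [Perm.mul_apply (σ * h), pairSwap_fstPos]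
    generalize σ * h = ρ at *
    rw [← sub_pos, ← Finset.sum_sub_distrib,
      ← Finset.sum_subset (Finset.subset_univ {i, j}), Finset.sum_pair hij.ne]
    · simp only [swap_apply_left, swap_apply_right]
      nlinarith
    · intro k _ hk
      simp only [Finset.mem_insert, Finset.mem_singleton, not_or] at hk
      rw [swap_apply_of_ne_of_ne hk.1 hk.2, sub_self]

lemma IsCanonical.eq_one {σ h : Perm (Fin (2*n+1))} (hh : h ∈ pairSymm n) (hσ : IsCanonical σ)
    (hσh : IsCanonical (σ * h)) : h = 1 := by
  have hcomm := partner_apply_comm hh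
  have hfst : ∀ i : Fin n, ∃ j : Fin n, h (fstPos i) = fstPos j := fun i => by
    have hc := hcomm (fstPos i)
    rcases pos_cases (h (fstPos i)) with h0 | hj | ⟨j, hj⟩
    · rw [h0, partner_zero, partner_fstPos, ← h0, h.apply_eq_iff_eq] at hc
      simp at hc
    · exact hj
    · rw [hj, partner_sndPos, partner_fstPos] at hc
      have := hσh.1 i
      rw [Perm.mul_apply, Perm.mul_apply, hj, ← hc] at this
      exact absurd (hσ.1 j) this.not_gt
  choose f hf using hfst
  have hsnd : ∀ i, h (sndPos i) = sndPos (f i) := fun i => by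
    rw [← partner_fstPos, ← hcomm, hf, partner_fstPos]
  have hmono : StrictMono fun i : Fin n => σ (fstPos i) := fun i j hij => hσ.2 i j hij
  have hfmono : StrictMono f := fun i j hij => by
    have := hσh.2 i j hij
    rw [Perm.mul_apply, Perm.mul_apply, hf, hf] at this
    exact hmono.lt_iff_lt.1 this
  have hfid : ∀ i, f i = i := fun i => by
    have hs : Function.Surjective f := Finite.surjective_of_injective hfmono.injective
    have : hfmono.orderIsoOfSurjective f hs = OrderIso.refl _ := Subsingleton.elim _ _
    exact DFunLike.congr_fun this i
  ext1 k
  rcases pos_cases k with rfl | ⟨i, rfl⟩ | ⟨i, rfl⟩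
  · have hc := hcomm 0
    rw [partner_zero] at hc
    rcases pos_cases (h 0) with h0 | ⟨j, hj⟩ | ⟨j, hj⟩
    · simpa using h0
    · rw [hj] at hc; simp at hc
    · rw [hj] at hc; simp at hc
  · simp [hf, hfid]
  · simp [hsnd, hfid]

section Field

variable {K V : Type*} [Field K] [AddCommGroup V] [Module K V]
  (α : V →ₗ[K] K) (ω : V →ₗ[K] V →ₗ[K] K)

/-- The summand of `wedgeEval` attached to a permutation. -/
def summand (v : Fin (2*n+1) → V) (σ : Perm (Fin (2*n+1))) : K :=
  (Perm.sign σ : ℤ) •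
    (α (v (σ 0)) * ∏ i : Fin n, ω (v (σ (fstPos i))) (v (σ (sndPos i))))

variable {α ω}

lemma summand_mul_flip (halt : ∀ x, ω x x = 0) (v : Fin (2*n+1) → V) (σ : Perm (Fin (2*n+1)))
    (i : Fin n) : summand α ω v (σ * flip i) = summand α ω v σ := by
  have hsign : Perm.sign (flip i) = -1 := Perm.sign_swap (fstPos_ne_sndPos i i)
  have hneg : ∀ x y, ω y x = -ω x y := fun x y => (LinearMap.IsAlt.neg halt x y).symm
  simp only [summand, Perm.sign_mul, hsign, Perm.mul_apply, flip_zero, flip_fstPos, flip_sndPos]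
  rw [← Finset.mul_prod_erase _ _ (Finset.mem_univ i),
    ← Finset.mul_prod_erase _ _ (Finset.mem_univ i)]
  rw [Finset.prod_congr rfl (g := fun k => ω (v (σ (fstPos k))) (v (σ (sndPos k))))
    (fun k hk => by simp [Finset.ne_of_mem_erase hk])]
  rw [if_pos rfl, if_pos rfl, hneg (v (σ (fstPos i)))]
  simp

lemma summand_mul_pairSwap (v : Fin (2*n+1) → V) (σ : Perm (Fin (2*n+1)))
    {i j : Fin n} (hij : i ≠ j) : summand α ω v (σ * pairSwap i j) = summand α ω v σ := by
  have hsign : Perm.sign (pairSwap i j) = 1 := by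
    rw [pairSwap, Perm.sign_mul, Perm.sign_swap (by simpa), Perm.sign_swap (by simpa)]
    simp
  simp only [summand, Perm.sign_mul, hsign, Perm.mul_apply, pairSwap_zero, pairSwap_fstPos,
    pairSwap_sndPos, mul_one]
  rw [Equiv.prod_comp (swap i j) fun k => ω (v (σ (fstPos k))) (v (σ (sndPos k)))]

lemma summand_mul (halt : ∀ x, ω x x = 0) (v : Fin (2*n+1) → V) (σ : Perm (Fin (2*n+1)))
    {h : Perm (Fin (2*n+1))} (hh : h ∈ pairSymm n) : summand α ω v (σ * h) = summand α ω v σ := by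
  induction hh using Subgroup.closure_induction generalizing σ with
  | mem h hh =>
    rcases hh with ⟨i, rfl⟩ | ⟨i, j, hij, rfl⟩
    · exact summand_mul_flip halt v σ i
    · exact summand_mul_pairSwap v σ hij
  | one => rw [mul_one]
  | mul x y _ _ hx hy => rw [← mul_assoc, hy, hx]
  | inv x _ hx => rw [← hx (σ * x⁻¹), inv_mul_cancel_right]

lemma summand_swap_mul (v : Fin (2*n+1) → V) (σ : Perm (Fin (2*n+1))) {a b : Fin (2*n+1)}
    (hab : a ≠ b) (hv : v a = v b) : summand α ω v (swap a b * σ) = -summand α ω v σ := by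
  have hswap : ∀ k, v (swap a b k) = v k := fun k => by
    rw [swap_apply_def]; split_ifs with h1 h2 <;> simp [*]
  simp [summand, Perm.sign_mul, Perm.sign_swap hab, hswap]

lemma summand_eq_zero (halt : ∀ x, ω x x = 0) (v : Fin (2*n+1) → V) (σ : Perm (Fin (2*n+1)))
    {a b : Fin (2*n+1)} (hab : a ≠ b) (hv : v a = v b)
    (hσ : σ⁻¹ * (swap a b * σ) ∈ pairSymm n) : summand α ω v σ = 0 := by
  have hsw : σ⁻¹ * (swap a b * σ) = swap (σ⁻¹ a) (σ⁻¹ b) := by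
    rw [Equiv.swap_mul_eq_mul_swap, inv_mul_cancel_left]
  rw [hsw] at hσ
  obtain ⟨x, rfl⟩ := σ.surjective a
  obtain ⟨y, rfl⟩ := σ.surjective b
  simp only [Perm.inv_def, Equiv.symm_apply_apply] at hσ
  have hxy : x ≠ y := fun h => hab (by rw [h])
  have hc := partner_apply_comm hσ x
  rw [swap_apply_left] at hc
  suffices ∃ i : Fin n, ω (v (σ (fstPos i))) (v (σ (sndPos i))) = 0 by
    obtain ⟨i, hi⟩ := this
    rw [summand, Finset.prod_eq_zero (Finset.mem_univ i) hi, mul_zero, smul_zero]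
  have hy : partner n x = x ∨ partner n x = y := by
    by_contra! hne
    rw [swap_apply_of_ne_of_ne hne.1 hne.2, (partner n).apply_eq_iff_eq] at hc
    exact hxy hc.symm
  rcases pos_cases x with rfl | ⟨i, rfl⟩ | ⟨i, rfl⟩
  · rw [partner_zero, swap_apply_left] at hc
    rcases pos_cases y with rfl | ⟨j, rfl⟩ | ⟨j, rfl⟩ <;> simp at hc hxy
  · rcases hy with hy | hy
    · simp at hy
    · rw [partner_fstPos] at hy
      exact ⟨i, by rw [hy, ← hv, halt]⟩
  · rcases hy with hy | hy
    · simp at hy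
    · rw [partner_sndPos] at hy
      exact ⟨i, by rw [hy, ← hv, halt]⟩

open Classical in
lemma wedgeEval_eq_sum (v : Fin (2*n+1) → V) :
    wedgeEval K n (fun x => α x) (fun x y => ω x y) v =
      ∑ σ : Perm (Fin (2*n+1)) with IsCanonical σ, summand α ω v σ := by
  unfold wedgeEval
  refine Finset.sum_congr (Finset.ext fun σ => ?_) fun σ _ => rfl
  simp only [Finset.mem_filter]
  rfl

open Classical in
lemma wedgeEval_eq_zero_of_eq (halt : ∀ x, ω x x = 0) (v : Fin (2*n+1) → V)
    {a b : Fin (2*n+1)} (hab : a ≠ b) (hv : v a = v b) :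
    wedgeEval K n (fun x => α x) (fun x y => ω x y) v = 0 := by
  let T : Perm (Fin (2*n+1)) ⧸ pairSymm n → K := Quotient.lift (summand α ω v) fun σ τ hστ => by
    have := summand_mul (α := α) halt v σ (QuotientGroup.leftRel_apply.1 hστ)
    rw [← this, mul_inv_cancel_left]
  have hT : ∀ σ : Perm (Fin (2*n+1)), T σ = summand α ω v σ := fun _ => rfl
  have hsum : wedgeEval K n (fun x => α x) (fun x y => ω x y) v = ∑ q, T q := by
    rw [wedgeEval_eq_sum]
    refine Finset.sum_bij (fun σ _ => (σ : Perm (Fin (2*n+1)) ⧸ pairSymm n))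
      (fun _ _ => Finset.mem_univ _) ?_ ?_ fun _ _ => rfl
    · intro σ hσ τ hτ hστ
      have hmem := QuotientGroup.eq.1 hστ
      have := (Finset.mem_filter.1 hσ).2.eq_one hmem
        (by rw [mul_inv_cancel_left]; exact (Finset.mem_filter.1 hτ).2)
      exact inv_mul_eq_one.1 this
    · intro q _
      induction q using QuotientGroup.induction_on with
      | H σ =>
        obtain ⟨h, hh, hc⟩ := exists_isCanonical σ
        exact ⟨σ * h, by simpa using hc, QuotientGroup.mk_mul_of_mem σ hh⟩
  rw [hsum]
  refine Finset.sum_involution (fun q _ => swap a b • q) ?_ ?_ (fun _ _ => Finset.mem_univ _) ?_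
  · intro q _
    induction q using QuotientGroup.induction_on with
    | H σ =>
      rw [MulAction.Quotient.smul_coe, smul_eq_mul, hT, hT, summand_swap_mul v σ hab hv,
        add_neg_cancel]
  · intro q _
    induction q using QuotientGroup.induction_on with
    | H σ =>
      intro hne heq
      rw [MulAction.Quotient.smul_coe, smul_eq_mul] at heq
      exact hne (summand_eq_zero halt v σ hab hv (QuotientGroup.eq.1 heq.symm))
  · intro q _
    rw [smul_smul, swap_mul_self, one_smul]

lemma exists_linear_summand (v : Fin (2*n+1) → V) (σ : Perm (Fin (2*n+1))) (k : Fin (2*n+1)) :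
    ∃ L : V →ₗ[K] K, (∀ x, summand α ω (Function.update v k x) σ = L x) ∧
      ∀ u, α u = 0 → ω u = 0 → ω.flip u = 0 → L u = 0 := by
  obtain ⟨l, rfl⟩ := σ.surjective k
  simp only [summand, Function.update_apply, σ.apply_eq_iff_eq]
  rcases pos_cases l with rfl | ⟨i, rfl⟩ | ⟨i, rfl⟩
  · refine ⟨((Perm.sign σ : ℤ) *
      ∏ i : Fin n, ω (v (σ (fstPos i))) (v (σ (sndPos i))) : K) • α, fun x => ?_, ?_⟩
    · simp; ring
    · intro u hu _ _; simp [hu]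
  · refine ⟨((Perm.sign σ : ℤ) * α (v (σ 0)) *
      ∏ j ∈ Finset.univ.erase i, ω (v (σ (fstPos j))) (v (σ (sndPos j))) : K) •
        ω.flip (v (σ (sndPos i))), fun x => ?_, ?_⟩
    · rw [← Finset.mul_prod_erase _ _ (Finset.mem_univ i)]
      rw [Finset.prod_congr rfl (g := fun k => ω (v (σ (fstPos k))) (v (σ (sndPos k))))
        (fun k hk => by simp [Finset.ne_of_mem_erase hk])]
      simp; ring
    · intro u _ hu _; simp [hu]
  · refine ⟨((Perm.sign σ : ℤ) * α (v (σ 0)) *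
      ∏ j ∈ Finset.univ.erase i, ω (v (σ (fstPos j))) (v (σ (sndPos j))) : K) •
        ω (v (σ (fstPos i))), fun x => ?_, ?_⟩
    · rw [← Finset.mul_prod_erase _ _ (Finset.mem_univ i)]
      rw [Finset.prod_congr rfl (g := fun k => ω (v (σ (fstPos k))) (v (σ (sndPos k))))
        (fun k hk => by simp [Finset.ne_of_mem_erase hk])]
      simp; ring
    · intro u _ _ hu
      have := LinearMap.congr_fun hu (v (σ (fstPos i)))
      simp only [LinearMap.flip_apply, LinearMap.zero_apply] at this
      simp [this]

lemma mul_wedgeEval_eq_zero (halt : ∀ x, ω x x = 0) (v : Fin (2*n+1) → V)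
    (c : Fin (2*n+1) → K) (hα : α (∑ i, c i • v i) = 0) (hω : ω (∑ i, c i • v i) = 0)
    (k : Fin (2*n+1)) : c k * wedgeEval K n (fun x => α x) (fun x y => ω x y) v = 0 := by
  classical
  choose L hL hL0 using fun σ => exists_linear_summand (α := α) (ω := ω) v σ k
  let W : V →ₗ[K] K := ∑ σ : Perm (Fin (2*n+1)) with IsCanonical σ, L σ
  have hW : ∀ x, wedgeEval K n (fun x => α x) (fun x y => ω x y) (Function.update v k x) = W x :=
    fun x => by simp [W, wedgeEval_eq_sum, hL]
  have hflip : ω.flip (∑ i, c i • v i) = 0 := LinearMap.ext fun y => by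
    rw [LinearMap.flip_apply, ← LinearMap.IsAlt.neg halt, hω]; simp
  have hWu : W (∑ i, c i • v i) = 0 := by
    simp only [W, LinearMap.sum_apply]
    exact Finset.sum_eq_zero fun σ _ => hL0 σ _ hα hω hflip
  rw [map_sum, Finset.sum_eq_single k, map_smul, ← hW, Function.update_eq_self] at hWu
  · exact hWu
  · intro i _ hi
    rw [map_smul, ← hW, wedgeEval_eq_zero_of_eq halt _ hi (by simp [hi]), smul_zero]
  · simp

/-- If `α ∧ ωⁿ ≠ 0` on a space of dimension `2n+1`, then `ker α ∩ rad ω = 0`. -/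
lemma eq_zero_of_wedgeEval_ne_zero (hrank : Module.finrank K V = 2*n+1)
    (halt : ∀ x, ω x x = 0)
    (hwedge : ∃ v : Fin (2*n+1) → V, wedgeEval K n (fun x => α x) (fun x y => ω x y) v ≠ 0)
    {u : V} (hα : α u = 0) (hω : ω u = 0) : u = 0 := by
  obtain ⟨v, hv⟩ := hwedge
  have hli : LinearIndependent K v := Fintype.linearIndependent_iff.2 fun c hc k =>
    (mul_eq_zero.1 (mul_wedgeEval_eq_zero halt v c (by simp [hc]) (by simp [hc]) k)).resolve_right
      hv
  let B := basisOfLinearIndependentOfCardEqFinrank hli (by simp [hrank])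
  have hB : ∑ i, B.repr u i • v i = u := by
    simpa [B] using B.sum_repr u
  rw [← hB]
  refine Finset.sum_eq_zero fun k _ => ?_
  have := mul_wedgeEval_eq_zero halt v (B.repr u) (by rw [hB, hα]) (by rw [hB, hω]) k
  rw [(mul_eq_zero.1 this).resolve_right hv, zero_smul]

end Field

end WedgeEval

/-- Let `(J,·,α,ω)` be a cosymplectic JJ-algebra with Reeb vector `ξ`,
`h = ker α`, and let `⊙` be the right-skew-symmetric product on `h` determined by
`ω(x⊙y, z) = ω(x, y·z)` for `x,y,z ∈ h`.  Then `D_ξ : x ↦ ξ·x` (which preserves `h`)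
is an anti-derivation of `(h,⊙)`: `D_ξ(x⊙y) = −D_ξ(x)⊙y − x⊙D_ξ(y)` on `h`. -/
theorem stmt9 {K V : Type*} [Field K] [AddCommGroup V] [Module K V]
    [FiniteDimensional K V] (h2 : (2 : K) ≠ 0) (h3 : (3 : K) ≠ 0)
    (n : ℕ) (hrank : Module.finrank K V = 2*n+1)
    (m : V →ₗ[K] V →ₗ[K] V)
    (hcomm : ∀ x y, m x y = m y x)
    (hjac : ∀ x y z, m x (m y z) + m y (m z x) + m z (m x y) = 0)
    (α : V →ₗ[K] K) (ω : V →ₗ[K] V →ₗ[K] K)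
    (halt : ∀ x, ω x x = 0)
    (hwedge : ∃ v, wedgeEval K n (fun x => α x) (fun x y => ω x y) v ≠ 0)
    (hαcl : ∀ x y, α (m x y) = 0)
    (hωcl : ∀ x y z, ω (m x y) z + ω (m z x) y + ω (m y z) x = 0)
    (ξ : V) (hξ1 : α ξ = 1) (hξ0 : ∀ y, ω ξ y = 0)
    (odot : V → V → V)
    (hodotmem : ∀ x y, α x = 0 → α y = 0 → α (odot x y) = 0)
    (hodot : ∀ x y z, α x = 0 → α y = 0 → α z = 0 → ω (odot x y) z = ω x (m y z))
    : ∀ x y, α x = 0 → α y = 0 →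
        m ξ (odot x y) = -(odot (m ξ x) y) - odot x (m ξ y) := by
  intro x y hx hy
  have hneg : ∀ a b, ω a b = -ω b a := fun a b => (LinearMap.IsAlt.neg halt b a).symm
  have hadj : ∀ a b, ω (m ξ a) b = ω a (m ξ b) := fun a b => by
    have h := hωcl ξ a b
    rw [hneg (m a b) ξ, hξ0, hcomm b ξ, hneg (m ξ b) a] at h
    linear_combination h
  rw [← sub_eq_zero]
  refine WedgeEval.eq_zero_of_wedgeEval_ne_zero hrank halt hwedge ?_ (LinearMap.ext fun w => ?_)
  · simp [hαcl, hodotmem, hx, hy]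
  · have key : ∀ z, α z = 0 →
        ω (m ξ (odot x y) - (-(odot (m ξ x) y) - odot x (m ξ y))) z = 0 := fun z hz => by
      have hj := congrArg (ω x) (hjac ξ y z)
      simp only [map_add, map_zero] at hj
      rw [hcomm z ξ, hcomm z (m ξ y)] at hj
      simp only [map_sub, map_neg, LinearMap.sub_apply, LinearMap.neg_apply]
      rw [hadj, hodot x y _ hx hy (hαcl _ _), hodot _ y z (hαcl _ _) hy hz,
        hodot x _ z hx (hαcl _ _) hz, hadj]
      linear_combination hj
    have h := key (w - α w • ξ) (by simp [hξ1])
    rw [map_sub, map_smul, hneg _ ξ, hξ0] at h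
    simpa using h
end

section
/- Let (h, ·, ω_h) be a 2n-dimensional symplectic Jacobi–Jordan algebra and D an anti-derivation of (h,·) with D² = 0 and ω_h(D(x), y) = ω_h(x, D(y)) for all x, y ∈ h. On J = Kξ ⊕ h define the commutative bilinear product • by x•y = x·y for x, y ∈ h, ξ•x = x•ξ = D(x) for x ∈ h, and ξ•ξ = 0; define the linear form α by α(ξ) = 1 and α|_h = 0, and the alternating bilinear form ω extending ω_h by ω(ξ, z) = 0 for all z. Then (J, •, α, ω) is a (2n+1)-dimensional cosymplectic Jacobi–Jordan algebra with Reeb vector ξ. -/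
theorem exists_ne_zero_forall_eq_zero {K H : Type*} [Field K] [AddCommGroup H] [Module K H]
    [FiniteDimensional K H] {k : ℕ} (hk : k < Module.finrank K H) (f : Fin k → H →ₗ[K] K) :
    ∃ x, x ≠ 0 ∧ ∀ i, f i x = 0 := by
  have h : LinearMap.ker (LinearMap.pi f) ≠ ⊥ :=
    LinearMap.ker_ne_bot_of_finrank_lt (by simpa using hk)
  obtain ⟨x, hx, hx0⟩ := (Submodule.ne_bot_iff _).1 h
  exact ⟨x, hx0, fun i => congrFun (LinearMap.mem_ker.1 hx) i⟩

/-- A non-degenerate alternating form on a space of dimension at least `2k` admits `k` mutually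
orthogonal hyperbolic pairs. -/
theorem exists_hyperbolic_pairs {K H : Type*} [Field K] [AddCommGroup H] [Module K H]
    [FiniteDimensional K H] (B : H →ₗ[K] H →ₗ[K] K) (halt : ∀ x, B x x = 0)
    (hnd : ∀ x, (∀ y, B x y = 0) → x = 0) (k : ℕ) (hk : 2 * k ≤ Module.finrank K H) :
    ∃ p q : ℕ → H, ∀ i < k, ∀ j < k,
      B (p i) (p j) = 0 ∧ B (q i) (q j) = 0 ∧ B (p i) (q j) = if i = j then 1 else 0 := by
  have hneg : ∀ x y, B x y = -B y x := fun x y => (LinearMap.IsAlt.neg halt y x).symm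
  induction k with
  | zero => exact ⟨0, 0, by simp⟩
  | succ k ih =>
    obtain ⟨p, q, h⟩ := ih (by omega)
    obtain ⟨x, hx0, hx⟩ := exists_ne_zero_forall_eq_zero (k := 2 * k) (by omega)
      (fun i => if (i : ℕ) < k then B (p i) else B (q (i - k)))
    have hpx : ∀ i < k, B (p i) x = 0 := fun i hi => by
      simpa [hi] using hx ⟨i, by omega⟩
    have hqx : ∀ i < k, B (q i) x = 0 := fun i hi => by
      simpa using hx ⟨i + k, by omega⟩
    obtain ⟨z, hz⟩ : ∃ z, B x z ≠ 0 := by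
      by_contra! hc
      exact hx0 (hnd x hc)
    let y := (B x z)⁻¹ • (z - ∑ i ∈ Finset.range k, (B (p i) z • q i - B (q i) z • p i))
    have hy : ∀ u, B u y = (B x z)⁻¹ *
        (B u z - ∑ j ∈ Finset.range k, B u (B (p j) z • q j - B (q j) z • p j)) := fun u => by
      rw [map_smul, map_sub, map_sum, smul_eq_mul]
    have hpy : ∀ i < k, B (p i) y = 0 := fun i hi => by
      have : ∑ j ∈ Finset.range k, B (p i) (B (p j) z • q j - B (q j) z • p j) = B (p i) z := by
        rw [Finset.sum_eq_single_of_mem i (by simpa using hi)]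
        · simp [h i hi i hi]
        · intro j hj hji
          simp [h i hi j (by simpa using hj), hji.symm]
      rw [hy, this, sub_self, mul_zero]
    have hqy : ∀ i < k, B (q i) y = 0 := fun i hi => by
      have : ∑ j ∈ Finset.range k, B (q i) (B (p j) z • q j - B (q j) z • p j) = B (q i) z := by
        rw [Finset.sum_eq_single_of_mem i (by simpa using hi)]
        · simp [h i hi i hi, hneg (q i) (p i)]
        · intro j hj hji
          have hj' : j < k := by simpa using hj
          simp [h i hi j hj', hneg (q i) (p j), h j hj' i hi, hji]
      rw [hy, this, sub_self, mul_zero]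
    have hxy : B x y = 1 := by
      have : ∑ j ∈ Finset.range k, B x (B (p j) z • q j - B (q j) z • p j) = 0 := by
        refine Finset.sum_eq_zero fun j hj => ?_
        have hj' : j < k := by simpa using hj
        simp [hneg x, hpx j hj', hqx j hj']
      rw [hy, this, sub_zero, inv_mul_cancel₀ hz]
    refine ⟨Function.update p k x, Function.update q k y, fun i hi j hj => ?_⟩
    rcases Nat.lt_succ_iff_lt_or_eq.1 hi with hi | rfl <;>
      rcases Nat.lt_succ_iff_lt_or_eq.1 hj with hj | rfl
    · simpa [hi.ne, hj.ne] using h i hi j hj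
    · simp [hi.ne, hpx i hi, hqy i hi, hpy i hi]
    · simp [hj.ne, hj.ne', hneg x, hneg y, hpx j hj, hqy j hj, hqx j hj]
    · simp [halt, hxy]

/-- If `α` and `ω` take on `v` the values of the standard cosymplectic forms on the standard basis,
then `α ∧ ωⁿ` takes the value `1` on `v`. -/
theorem wedgeEval_eq_one {K V : Type*} [Field K] (n : ℕ) (α : V → K) (ω : V → V → K)
    (v : Fin (2 * n + 1) → V) (hα : ∀ i, α (v i) = if (i : ℕ) = 0 then 1 else 0)
    (hω : ∀ i j, i < j →
      ω (v i) (v j) = if (i : ℕ) % 2 = 1 ∧ (j : ℕ) = i + 1 then 1 else 0) :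
    wedgeEval K n α ω v = 1 := by
  unfold wedgeEval
  rw [Finset.sum_eq_single_of_mem 1]
  · have hprod : ∀ i : Fin n, ω (v ⟨2 * (i : ℕ) + 1, by omega⟩)
        (v ⟨2 * (i : ℕ) + 2, by omega⟩) = 1 := fun i => by
      rw [hω _ _ (by simp)]
      simp [Nat.add_mod]
    simp [hα, hprod]
  · simp
  · intro σ hσ hne
    simp only [Finset.mem_filter, Finset.mem_univ, true_and] at hσ
    obtain ⟨hlt, hmono⟩ := hσ
    by_contra hterm
    apply hne
    have hterm' := right_ne_zero_of_smul hterm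
    have h0 := left_ne_zero_of_mul hterm'
    have hp := Finset.prod_ne_zero_iff.1 (right_ne_zero_of_mul hterm')
    rw [hα] at h0
    have h0' : (σ ⟨0, by omega⟩ : ℕ) = 0 := by
      by_contra hc
      exact h0 (if_neg hc)
    have hpair : ∀ i : Fin n, (σ ⟨2 * (i : ℕ) + 1, by omega⟩ : ℕ) % 2 = 1 ∧
        (σ ⟨2 * (i : ℕ) + 2, by omega⟩ : ℕ) = σ ⟨2 * (i : ℕ) + 1, by omega⟩ + 1 := fun i => by
      have hi := hp i (Finset.mem_univ i)
      rw [hω _ _ (hlt i)] at hi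
      by_contra hc
      exact hi (if_neg hc)
    let c : Fin n → Fin n := fun i => ⟨(σ ⟨2 * (i : ℕ) + 1, by omega⟩ : ℕ) / 2, by
      have := hpair i
      have := (σ ⟨2 * (i : ℕ) + 2, by omega⟩).2
      omega⟩
    have hc : StrictMono c := fun i j hij => by
      have h1 : (σ ⟨2 * (i : ℕ) + 1, by omega⟩ : ℕ) < σ ⟨2 * (j : ℕ) + 1, by omega⟩ :=
        hmono i j hij
      have := hpair i
      have := hpair j
      simp only [c, Fin.mk_lt_mk]
      omega
    have hcid : c = id := le_antisymm hc.le_id hc.id_le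
    have hval : ∀ i : Fin n, (σ ⟨2 * (i : ℕ) + 1, by omega⟩ : ℕ) / 2 = i := fun i =>
      congrArg Fin.val (congrFun hcid i)
    ext ⟨m, hm⟩
    rw [Equiv.Perm.one_apply]
    obtain rfl | ⟨i, rfl | rfl⟩ : m = 0 ∨ ∃ i, m = 2 * i + 1 ∨ m = 2 * i + 2 := by
      rcases Nat.eq_zero_or_pos m with h | h
      · exact Or.inl h
      · exact Or.inr ⟨(m - 1) / 2, by omega⟩
    · exact h0'
    · have h1 := hpair ⟨i, by omega⟩
      have h2 := hval ⟨i, by omega⟩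
      dsimp only at h1 h2 ⊢
      omega
    · have h1 := hpair ⟨i, by omega⟩
      have h2 := hval ⟨i, by omega⟩
      dsimp only at h1 h2 ⊢
      omega


/-- Let `(h,·,ω_h)` be a `2n`-dimensional symplectic JJ-algebra and `D` an
anti-derivation with `D² = 0` and `ω_h(D x, y) = ω_h(x, D y)`.  On `J = Kξ ⊕ h`
(modelled as `K × h`, `ξ = (1,0)`) define `x•y = x·y` on `h`, `ξ•x = D(x)`, `ξ•ξ = 0`,
`α(s,x) = s` and `ω((s,x),(t,y)) = ω_h(x,y)`.  Then `(J,•,α,ω)` is a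
`(2n+1)`-dimensional cosymplectic JJ-algebra with Reeb vector `ξ`. -/
theorem stmt12 {K H : Type*} [Field K] [AddCommGroup H] [Module K H]
    [FiniteDimensional K H] (h2 : (2 : K) ≠ 0) (h3 : (3 : K) ≠ 0)
    (n : ℕ) (hrank : Module.finrank K H = 2*n)
    (mh : H →ₗ[K] H →ₗ[K] H)
    (hcomm : ∀ x y, mh x y = mh y x)
    (hjac : ∀ x y z, mh x (mh y z) + mh y (mh z x) + mh z (mh x y) = 0)
    (ωh : H →ₗ[K] H →ₗ[K] K)
    (halt : ∀ x, ωh x x = 0)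
    (hnd : ∀ x, (∀ y, ωh x y = 0) → x = 0)
    (hωcl : ∀ x y z, ωh (mh x y) z + ωh (mh z x) y + ωh (mh y z) x = 0)
    (D : H →ₗ[K] H)
    (hD : ∀ x y, D (mh x y) = -(mh (D x) y) - mh x (D y))
    (hD2 : ∀ x, D (D x) = 0)
    (hDsym : ∀ x y, ωh (D x) y = ωh x (D y))
    (bt : K × H → K × H → K × H)
    (hbt : ∀ u v, bt u v = ((0 : K), mh u.2 v.2 + u.1 • D v.2 + v.1 • D u.2))
    (αJ : K × H → K) (hαJ : ∀ u, αJ u = u.1)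
    (ωJ : K × H → K × H → K) (hωJ : ∀ u v, ωJ u v = ωh u.2 v.2)
    (ξ : K × H) (hξ : ξ = ((1 : K), (0 : H))) :
    (∀ u v, bt u v = bt v u) ∧
      (∀ u v w, bt u (bt v w) + bt v (bt w u) + bt w (bt u v) = 0) ∧
      Module.finrank K (K × H) = 2*n+1 ∧
      (∀ u, ωJ u u = 0) ∧
      (∃ v, wedgeEval K n αJ ωJ v ≠ 0) ∧
      (∀ u v, αJ (bt u v) = 0) ∧
      (∀ u v w, ωJ (bt u v) w + ωJ (bt w u) v + ωJ (bt v w) u = 0) ∧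
      αJ ξ = 1 ∧ (∀ u, ωJ ξ u = 0) := by
  have hneg : ∀ x y, ωh x y = -ωh y x := fun x y => (LinearMap.IsAlt.neg halt y x).symm
  refine ⟨fun u v => ?_, fun u v w => ?_, ?_, fun u => ?_, ?_, fun u v => ?_, fun u v w => ?_,
    ?_, fun u => ?_⟩
  · rw [hbt, hbt, hcomm]
    congr 1
    abel
  · simp only [hbt, Prod.mk_add_mk, add_zero, zero_smul, Prod.mk_eq_zero, true_and, map_add,
      map_smul, hD, hD2, smul_zero, hcomm (D _)]
    linear_combination (norm := module) hjac u.2 v.2 w.2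
  · rw [Module.finrank_prod, Module.finrank_self, hrank, add_comm]
  · rw [hωJ, halt]
  · obtain ⟨p, q, h⟩ := exists_hyperbolic_pairs ωh halt hnd n hrank.ge
    refine ⟨fun i => if (i : ℕ) = 0 then (1, 0) else
      if (i : ℕ) % 2 = 1 then (0, p (i / 2)) else (0, q (i / 2 - 1)), ?_⟩
    rw [wedgeEval_eq_one]
    · exact one_ne_zero
    · intro i
      rw [hαJ]
      split_ifs <;> rfl
    · intro i j hij
      have hij' : (i : ℕ) < j := hij
      have hj := j.2
      have hj0 : (j : ℕ) ≠ 0 := by omega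
      simp only [hωJ, hj0, if_false]
      by_cases hi0 : (i : ℕ) = 0
      · simp [hi0]
      · by_cases hi : (i : ℕ) % 2 = 1 <;> by_cases hj2 : (j : ℕ) % 2 = 1 <;>
          simp only [hi0, hi, hj2, if_true, if_false, true_and, false_and]
        · rw [(h _ (by omega) _ (by omega)).1, if_neg (by omega)]
        · rw [(h _ (by omega) _ (by omega)).2.2]
          exact if_congr (by omega) rfl rfl
        · rw [hneg, (h _ (by omega) _ (by omega)).2.2, if_neg (by omega), neg_zero]
        · rw [(h _ (by omega) _ (by omega)).2.1]
  · rw [hαJ, hbt]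
  · simp only [hωJ, hbt, map_add, map_smul, LinearMap.add_apply, LinearMap.smul_apply, smul_eq_mul]
    linear_combination hωcl u.2 v.2 w.2 + u.1 * (hDsym w.2 v.2 + hneg w.2 (D v.2)) +
      v.1 * (hDsym w.2 u.2 + hneg w.2 (D u.2)) + w.1 * (hDsym v.2 u.2 + hneg v.2 (D u.2))
  · rw [hαJ, hξ]
  · rw [hωJ, hξ, map_zero, LinearMap.zero_apply]
end
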